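/- With the notation below, for every δ ∈ (0,1/2) and every d > 0 there exist c > 0, m₀, and a sequence of integers r̃(m) such that: (i) liminf_{m→∞} binom(m, ≤ r̃(m)) / 2^m ≥ (1−d)(1−H(δ)), and (ii) for all m ≥ m₀, H(W^{(m)}_{≤ r̃(m)} | W^{(m)}_{> r̃(m)}) ≤ 2^m · 2^{−c√m}. -/

import Mathlib

open MeasureTheory

/-- Index set: binary strings of length `m` (indexing both coordinates and monomials). -/
abbrev Idx (m : ℕ) := Fin m → ZMod 2

/-- Hamming weight of a binary string. -/
def wt {m : ℕ} (x : Idx m) : ℕ := (Finset.univ.filter (fun i => x i = 1)).card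

/-- The 2×2 base matrix `[[1,0],[1,1]]` (rows/columns indexed by `F₂`):
entry `(a,b)` is `0` iff `a = 0` and `b = 1`. -/
def base : ZMod 2 → ZMod 2 → ZMod 2 := fun a b => if a = 0 ∧ b = 1 then 0 else 1

/-- The `m`-fold Kronecker power `G = [[1,0],[1,1]]^{⊗ m}`, as a matrix indexed by
binary strings of length `m`. -/
def Gmat (m : ℕ) : Matrix (Idx m) (Idx m) (ZMod 2) := fun x y => ∏ i, base (x i) (y i)

/-- The Bernoulli(δ) measure on `F₂` (probability `δ` of `1`). -/
noncomputable def bern2 (δ : ℝ) : Measure (ZMod 2) :=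
  ENNReal.ofReal δ • Measure.dirac 1 + ENNReal.ofReal (1 - δ) • Measure.dirac 0

/-- The law of the i.i.d. Bernoulli(δ) noise vector `Z = (Z_x)_{x ∈ F₂^m}`. -/
noncomputable def noise (m : ℕ) (δ : ℝ) : Measure (Idx m → ZMod 2) :=
  Measure.pi (fun _ => bern2 δ)

/-- The transformed noise vector `W = G Z`. -/
def Wfun (m : ℕ) (z : Idx m → ZMod 2) : Idx m → ZMod 2 := (Gmat m).mulVec z

/-- `W_r`: the coordinates of `W` whose index has Hamming weight exactly `r`. -/
def Wr (m r : ℕ) (z : Idx m → ZMod 2) : {x : Idx m // wt x = r} → ZMod 2 :=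
  fun x => Wfun m z x.val

/-- `W_{>r}`: the coordinates of `W` whose index has Hamming weight `> r`. -/
def Wgt (m r : ℕ) (z : Idx m → ZMod 2) : {x : Idx m // r < wt x} → ZMod 2 :=
  fun x => Wfun m z x.val

/-- `W_{≤r}`: the coordinates of `W` whose index has Hamming weight `≤ r`. -/
def Wle (m r : ℕ) (z : Idx m → ZMod 2) : {x : Idx m // wt x ≤ r} → ZMod 2 :=
  fun x => Wfun m z x.val

/-- Base-2 Shannon entropy of a random variable `X` (with finitely many values)
on the probability space `(Ω, μ)`: `H(X) = -∑ₛ P(X = s) log₂ P(X = s)`. -/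
noncomputable def ent {Ω S : Type*} [MeasurableSpace Ω] (μ : Measure Ω) (X : Ω → S) : ℝ :=
  -∑' s : S, (μ (X ⁻¹' {s})).toReal * Real.logb 2 (μ (X ⁻¹' {s})).toReal

/-- Conditional entropy `H(X|Y) = H(X,Y) - H(Y)`. -/
noncomputable def condEnt {Ω S T : Type*} [MeasurableSpace Ω] (μ : Measure Ω)
    (X : Ω → S) (Y : Ω → T) : ℝ :=
  ent μ (fun ω => (X ω, Y ω)) - ent μ Y

/-- The binary entropy function `H(δ) = -δ log₂ δ - (1-δ) log₂ (1-δ)`. -/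
noncomputable def Hbin (δ : ℝ) : ℝ :=
  -(δ * Real.logb 2 δ) - (1 - δ) * Real.logb 2 (1 - δ)

/-- `binom(m, ≤ r) = ∑_{i=0}^{r} binom(m,i)`. -/
def binomLe (m r : ℕ) : ℕ := ∑ i ∈ Finset.range (r + 1), m.choose i

/-! ### Averaging operators on the Boolean cube -/

section Cube

variable {ι : Type*}

/-- The Bernoulli(`δ`) weight of a bit. -/
noncomputable def bitWeight (δ : ℝ) (b : ZMod 2) : ℝ := if b = 1 then δ else 1 - δ

/-- The product Bernoulli(`δ`) weight of a point of the cube. -/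
noncomputable def cubeWeight [Fintype ι] (δ : ℝ) (z : ι → ZMod 2) : ℝ := ∏ i, bitWeight δ (z i)

/-- The expectation of `f` under the product Bernoulli(`δ`) law. -/
noncomputable def cubeMean [Fintype ι] [DecidableEq ι] (δ : ℝ) (f : (ι → ZMod 2) → ℝ) : ℝ :=
  ∑ z, cubeWeight δ z * f z

/-- Averaging of `f` over the coordinate `i`. -/
noncomputable def avgAt [DecidableEq ι] (δ : ℝ) (i : ι) (f : (ι → ZMod 2) → ℝ) : (ι → ZMod 2) → ℝ :=
  fun z => (1 - δ) * f (Function.update z i 0) + δ * f (Function.update z i 1)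

/-- Successive averaging of `f` over the coordinates of a list. -/
noncomputable def avgList [DecidableEq ι]
    (δ : ℝ) (l : List ι) (f : (ι → ZMod 2) → ℝ) : (ι → ZMod 2) → ℝ :=
  l.foldr (avgAt δ) f

/-- `f` does not depend on the coordinate `i`. -/
def IndepAt [DecidableEq ι] (i : ι) (f : (ι → ZMod 2) → ℝ) : Prop :=
  ∀ z b, f (Function.update z i b) = f z

theorem avgAt_of_indepAt [DecidableEq ι] {δ : ℝ} {i : ι} {f : (ι → ZMod 2) → ℝ} (h : IndepAt i f) :
    avgAt δ i f = f := by
  funext z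
  simp only [avgAt, h z]
  ring

theorem indepAt_avgAt_self [DecidableEq ι] (δ : ℝ) (i : ι) (f : (ι → ZMod 2) → ℝ) :
    IndepAt i (avgAt δ i f) := by
  intro z b
  simp [avgAt]

theorem IndepAt.avgAt [DecidableEq ι]
    {i : ι} {f : (ι → ZMod 2) → ℝ} (h : IndepAt i f) (δ : ℝ) (j : ι) :
    IndepAt i (avgAt δ j f) := by
  by_cases hij : i = j
  · subst hij
    exact indepAt_avgAt_self δ i f
  · intro z b
    simp only [_root_.avgAt]
    rw [Function.update_comm hij, Function.update_comm hij, h, h]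

theorem IndepAt.avgList [DecidableEq ι]
    {i : ι} {f : (ι → ZMod 2) → ℝ} (h : IndepAt i f) (δ : ℝ) (l : List ι) :
    IndepAt i (avgList δ l f) := by
  induction l with
  | nil => exact h
  | cons j l ih => exact ih.avgAt δ j

theorem indepAt_avgList_of_mem [DecidableEq ι]
    {δ : ℝ} {i : ι} {l : List ι} (f : (ι → ZMod 2) → ℝ) (hi : i ∈ l) :
    IndepAt i (avgList δ l f) := by
  induction l with
  | nil => simp at hi
  | cons j l ih =>
    rcases List.mem_cons.1 hi with rfl | hi
    · exact indepAt_avgAt_self δ i _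
    · exact (ih hi).avgAt δ j

theorem eq_of_forall_indepAt [Fintype ι] [DecidableEq ι]
    {f : (ι → ZMod 2) → ℝ} (h : ∀ i, IndepAt i f) (z w : ι → ZMod 2) :
    f z = f w := by
  have key : ∀ s : Finset ι, f (s.piecewise w z) = f z := by
    intro s
    induction s using Finset.induction_on with
    | empty => simp
    | insert j s _ ih => rw [Finset.piecewise_insert, h j, ih]
  simpa using (key Finset.univ).symm

theorem avgAt_comm [DecidableEq ι] (δ : ℝ) (i j : ι) (f : (ι → ZMod 2) → ℝ) :
    avgAt δ i (avgAt δ j f) = avgAt δ j (avgAt δ i f) := by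
  by_cases hij : i = j
  · rw [hij]
  · funext z
    simp only [avgAt, Function.update_comm hij]
    ring

theorem avgAt_sum [DecidableEq ι]
    {J : Type*} (s : Finset J) (δ : ℝ) (i : ι) (f : J → (ι → ZMod 2) → ℝ) :
    avgAt δ i (fun z => ∑ j ∈ s, f j z) = fun z => ∑ j ∈ s, avgAt δ i (f j) z := by
  funext z
  simp only [avgAt, Finset.sum_add_distrib, Finset.mul_sum]

theorem avgList_sum [DecidableEq ι] {J : Type*} (s : Finset J) (δ : ℝ) (l : List ι)
    (f : J → (ι → ZMod 2) → ℝ) :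
    avgList δ l (fun z => ∑ j ∈ s, f j z) = fun z => ∑ j ∈ s, avgList δ l (f j) z := by
  induction l with
  | nil => rfl
  | cons i l ih =>
    simp only [avgList, List.foldr_cons] at ih ⊢
    rw [ih, avgAt_sum]

theorem zmod_two_cases (b : ZMod 2) : b = 0 ∨ b = 1 := by
  revert b
  decide

theorem update_zero_add_update_one [DecidableEq ι] (i : ι) (h : (ι → ZMod 2) → ℝ) (z : ι → ZMod 2) :
    h (Function.update z i 0) + h (Function.update z i 1) = h z + h (z + Pi.single i 1) := by
  rcases zmod_two_cases (z i) with hz | hz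
  · have e1 : Function.update z i 0 = z := by rw [← hz, Function.update_eq_self]
    have e2 : Function.update z i 1 = z + Pi.single i 1 := by
      funext j
      by_cases hj : j = i
      · subst hj; simp [hz]
      · simp [hj]
    rw [e1, e2]
  · have e1 : Function.update z i 1 = z := by rw [← hz, Function.update_eq_self]
    have e2 : Function.update z i 0 = z + Pi.single i 1 := by
      funext j
      by_cases hj : j = i
      · subst hj; simp [hz]; decide
      · simp [hj]
    rw [e1, e2, add_comm]

theorem sum_update_zero_add_update_one [Fintype ι] [DecidableEq ι] (i : ι) (h : (ι → ZMod 2) → ℝ) :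
    ∑ z, (h (Function.update z i 0) + h (Function.update z i 1)) = 2 * ∑ z, h z := by
  have hflip : ∑ z, h (z + Pi.single i 1) = ∑ z, h z :=
    Fintype.sum_equiv (Equiv.addRight (Pi.single i (1 : ZMod 2))) _ _ fun _ => by simp
  simp only [update_zero_add_update_one, Finset.sum_add_distrib, hflip]
  ring

theorem cubeWeight_update [Fintype ι] [DecidableEq ι]
    (δ : ℝ) (z : ι → ZMod 2) (i : ι) (b : ZMod 2) :
    cubeWeight δ (Function.update z i b)
      = bitWeight δ b * ∏ j ∈ Finset.univ.erase i, bitWeight δ (z j) := by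
  rw [cubeWeight, ← Finset.mul_prod_erase _ _ (Finset.mem_univ i)]
  congr 1
  · simp
  · refine Finset.prod_congr rfl fun j hj => ?_
    rw [Function.update_of_ne (Finset.ne_of_mem_erase hj)]

theorem cubeMean_avgAt_mul [Fintype ι] [DecidableEq ι] (δ : ℝ) (i : ι) (f g : (ι → ZMod 2) → ℝ) :
    cubeMean δ (fun z => avgAt δ i f z * g z) = cubeMean δ (fun z => f z * avgAt δ i g z) := by
  have h2 : (2 : ℝ) ≠ 0 := two_ne_zero
  apply mul_left_cancel₀ h2
  simp only [cubeMean]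
  rw [← sum_update_zero_add_update_one i, ← sum_update_zero_add_update_one i]
  refine Finset.sum_congr rfl fun z _ => ?_
  simp only [cubeWeight_update, indepAt_avgAt_self δ i _ z]
  simp only [avgAt, bitWeight]
  simp
  ring

theorem sum_cubeWeight [Fintype ι] [DecidableEq ι]
    (δ : ℝ) : ∑ z : ι → ZMod 2, cubeWeight δ z = 1 := by
  have h := Finset.prod_univ_sum (fun _ : ι => (Finset.univ : Finset (ZMod 2)))
    (fun _ b => bitWeight δ b)
  rw [Fintype.piFinset_univ] at h
  simp only [cubeWeight]
  rw [← h]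
  refine Finset.prod_eq_one fun i _ => ?_
  have : (Finset.univ : Finset (ZMod 2)) = {0, 1} := by decide
  rw [this, Finset.sum_pair (by decide)]
  simp [bitWeight]

theorem cubeMean_const [Fintype ι] [DecidableEq ι]
    (δ c : ℝ) : cubeMean δ (fun _ : ι → ZMod 2 => c) = c := by
  rw [cubeMean, ← Finset.sum_mul, sum_cubeWeight, one_mul]

theorem cubeMean_avgAt [Fintype ι] [DecidableEq ι] (δ : ℝ) (i : ι) (f : (ι → ZMod 2) → ℝ) :
    cubeMean δ (avgAt δ i f) = cubeMean δ f := by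
  have h := cubeMean_avgAt_mul δ i f (fun _ => 1)
  have h1 : avgAt δ i (fun _ => (1 : ℝ)) = fun _ => 1 := avgAt_of_indepAt fun _ _ => rfl
  simpa [h1] using h

theorem cubeMean_avgList [Fintype ι] [DecidableEq ι] (δ : ℝ) (l : List ι) (f : (ι → ZMod 2) → ℝ) :
    cubeMean δ (avgList δ l f) = cubeMean δ f := by
  induction l with
  | nil => rfl
  | cons i l ih => rw [← ih]; exact cubeMean_avgAt δ i _

theorem avgList_univ [Fintype ι] [DecidableEq ι] (δ : ℝ) (f : (ι → ZMod 2) → ℝ) (z : ι → ZMod 2) :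
    avgList δ Finset.univ.toList f z = cubeMean δ f := by
  have hc : avgList δ Finset.univ.toList f
      = fun _ => avgList δ Finset.univ.toList f z := by
    funext w
    exact eq_of_forall_indepAt (fun i => indepAt_avgList_of_mem f (by simp)) w z
  rw [← cubeMean_avgList δ Finset.univ.toList f]
  conv_rhs => rw [hc]
  rw [cubeMean_const]

theorem cubeWeight_nonneg [Fintype ι] {δ : ℝ} (h0 : 0 ≤ δ) (h1 : δ ≤ 1) (z : ι → ZMod 2) :
    0 ≤ cubeWeight δ z := by
  refine Finset.prod_nonneg fun i _ => ?_
  rw [bitWeight]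
  split_ifs <;> linarith

theorem cubeWeight_pos [Fintype ι] {δ : ℝ} (h0 : 0 < δ) (h1 : δ < 1) (z : ι → ZMod 2) :
    0 < cubeWeight δ z := by
  refine Finset.prod_pos fun i _ => ?_
  rw [bitWeight]
  split_ifs <;> linarith

theorem cubeMean_mono [Fintype ι] [DecidableEq ι]
    {δ : ℝ} (h0 : 0 ≤ δ) (h1 : δ ≤ 1) {f g : (ι → ZMod 2) → ℝ}
    (h : ∀ z, f z ≤ g z) : cubeMean δ f ≤ cubeMean δ g :=
  Finset.sum_le_sum fun z _ => mul_le_mul_of_nonneg_left (h z) (cubeWeight_nonneg h0 h1 z)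

theorem cubeMean_sub [Fintype ι] [DecidableEq ι] (δ : ℝ) (f g : (ι → ZMod 2) → ℝ) :
    cubeMean δ (fun z => f z - g z) = cubeMean δ f - cubeMean δ g := by
  simp only [cubeMean, mul_sub, Finset.sum_sub_distrib]

theorem cubeMean_add [Fintype ι] [DecidableEq ι] (δ : ℝ) (f g : (ι → ZMod 2) → ℝ) :
    cubeMean δ (fun z => f z + g z) = cubeMean δ f + cubeMean δ g := by
  simp only [cubeMean, mul_add, Finset.sum_add_distrib]

theorem cubeMean_const_mul [Fintype ι] [DecidableEq ι] (δ c : ℝ) (f : (ι → ZMod 2) → ℝ) :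
    cubeMean δ (fun z => c * f z) = c * cubeMean δ f := by
  simp only [cubeMean, Finset.mul_sum]
  exact Finset.sum_congr rfl fun z _ => by ring

theorem cubeMean_sum [Fintype ι] [DecidableEq ι]
    {J : Type*} (s : Finset J) (δ : ℝ) (f : J → (ι → ZMod 2) → ℝ) :
    cubeMean δ (fun z => ∑ j ∈ s, f j z) = ∑ j ∈ s, cubeMean δ (f j) := by
  simp only [cubeMean, Finset.mul_sum]
  exact Finset.sum_comm

/-! ### Second moment of a sum of functions on scattered coordinate sets -/

theorem cubeMean_sq_sub_avgAt [Fintype ι] [DecidableEq ι] (δ : ℝ) (i : ι) (h : (ι → ZMod 2) → ℝ) :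
    cubeMean δ (fun z => (h z - avgAt δ i h z) ^ 2)
      = cubeMean δ (fun z => h z ^ 2) - cubeMean δ (fun z => avgAt δ i h z ^ 2) := by
  have h1 := cubeMean_avgAt_mul δ i h (avgAt δ i h)
  rw [avgAt_of_indepAt (indepAt_avgAt_self δ i h)] at h1
  have h2 : ∀ z, (h z - avgAt δ i h z) ^ 2
      = (h z ^ 2 + avgAt δ i h z ^ 2) - 2 * (h z * avgAt δ i h z) := fun z => by ring
  simp only [h2, cubeMean_sub, cubeMean_add, cubeMean_const_mul, ← h1, pow_two]
  ring

theorem cubeMean_sq_sum_sub_le [Fintype ι] [DecidableEq ι]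
    {J : Type*} [Fintype J] {δ θ : ℝ} (h0 : 0 ≤ δ) (h1 : δ ≤ 1)
    (f : J → (ι → ZMod 2) → ℝ) (B : J → ι → Prop) [∀ j i, Decidable (B j i)]
    (hB : ∀ j i, ¬ B j i → IndepAt i (f j))
    (hθ : ∀ i, ((Finset.univ.filter fun j => B j i).card : ℝ) ≤ θ) (l : List ι) :
    cubeMean δ (fun z => (∑ j, f j z) ^ 2)
        - cubeMean δ (fun z => (avgList δ l (fun z => ∑ j, f j z) z) ^ 2)
      ≤ θ * ∑ j, (cubeMean δ (fun z => f j z ^ 2)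
          - cubeMean δ (fun z => avgList δ l (f j) z ^ 2)) := by
  induction l with
  | nil => simp [avgList]
  | cons i l ih =>
    have step : cubeMean δ (fun z => (avgList δ l (fun z => ∑ j, f j z) z) ^ 2)
        - cubeMean δ (fun z => (avgList δ (i :: l) (fun z => ∑ j, f j z) z) ^ 2)
        ≤ θ * ∑ j, (cubeMean δ (fun z => avgList δ l (f j) z ^ 2)
          - cubeMean δ (fun z => avgList δ (i :: l) (f j) z ^ 2)) := by
      have hc : ∀ g : (ι → ZMod 2) → ℝ, avgList δ (i :: l) g = avgAt δ i (avgList δ l g) :=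
        fun _ => rfl
      simp only [hc]
      simp only [← cubeMean_sq_sub_avgAt]
      rw [← cubeMean_sum, ← cubeMean_const_mul]
      refine cubeMean_mono h0 h1 fun z => ?_
      rw [avgList_sum, avgAt_sum, ← Finset.sum_sub_distrib]
      set x : J → ℝ := fun j => avgList δ l (f j) z - avgAt δ i (avgList δ l (f j)) z with hx
      have hx0 : ∀ j, ¬ B j i → x j = 0 := fun j hj => by
        rw [hx]
        simp only
        rw [avgAt_of_indepAt ((hB j i hj).avgList δ l), sub_self]
      have e1 : ∑ j, x j = ∑ j ∈ Finset.univ.filter (fun j => B j i), x j := by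
        rw [Finset.sum_filter]
        exact Finset.sum_congr rfl fun j _ => by
          split_ifs with h
          · rfl
          · exact hx0 j h
      have e2 : ∑ j ∈ Finset.univ.filter (fun j => B j i), x j ^ 2 ≤ ∑ j, x j ^ 2 :=
        Finset.sum_le_univ_sum_of_nonneg fun j => sq_nonneg _
      calc (∑ j, x j) ^ 2
          = (∑ j ∈ Finset.univ.filter (fun j => B j i), x j) ^ 2 := by rw [e1]
        _ ≤ ((Finset.univ.filter fun j => B j i).card : ℝ)
              * ∑ j ∈ Finset.univ.filter (fun j => B j i), x j ^ 2 :=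
            sq_sum_le_card_mul_sum_sq
        _ ≤ θ * ∑ j, x j ^ 2 :=
            mul_le_mul (hθ i) e2 (Finset.sum_nonneg fun j _ => sq_nonneg _)
              ((Nat.cast_nonneg _).trans (hθ i))
    simp only [Finset.sum_sub_distrib] at step ih ⊢
    linarith

/-- If each coordinate is relevant to at most `θ` of the functions `f j`, all bounded by `1`,
then the variance of `∑ j, f j` is at most `θ` times the number of functions. -/
theorem variance_sum_le [Fintype ι] [DecidableEq ι]
    {J : Type*} [Fintype J] {δ θ : ℝ} (h0 : 0 ≤ δ) (h1 : δ ≤ 1)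
    (f : J → (ι → ZMod 2) → ℝ) (B : J → ι → Prop) [∀ j i, Decidable (B j i)]
    (hB : ∀ j i, ¬ B j i → IndepAt i (f j)) (hf : ∀ j z, |f j z| ≤ 1) (hθ0 : 0 ≤ θ)
    (hθ : ∀ i, ((Finset.univ.filter fun j => B j i).card : ℝ) ≤ θ) :
    cubeMean δ (fun z => (∑ j, f j z - ∑ j, cubeMean δ (f j)) ^ 2) ≤ θ * Fintype.card J := by
  have h := cubeMean_sq_sum_sub_le h0 h1 f B hB hθ Finset.univ.toList
  simp only [avgList_univ, cubeMean_const, cubeMean_sum] at h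
  have e : ∀ z, (∑ j, f j z - ∑ j, cubeMean δ (f j)) ^ 2
      = ((∑ j, f j z) ^ 2 - 2 * (∑ j, cubeMean δ (f j)) * ∑ j, f j z)
        + (∑ j, cubeMean δ (f j)) ^ 2 := fun z => by ring
  simp only [e, cubeMean_add, cubeMean_sub, cubeMean_const_mul, cubeMean_const, cubeMean_sum]
  have h2 : ∑ j, (cubeMean δ (fun z => f j z ^ 2) - cubeMean δ (f j) ^ 2) ≤ ∑ _j : J, (1 : ℝ) := by
    refine Finset.sum_le_sum fun j _ => ?_
    have : cubeMean δ (fun z => f j z ^ 2) ≤ cubeMean δ (fun _ => 1) :=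
      cubeMean_mono h0 h1 fun z => (sq_le_one_iff_abs_le_one _).2 (hf j z)
    rw [cubeMean_const] at this
    nlinarith [sq_nonneg (cubeMean δ (f j))]
  rw [Finset.sum_const, Finset.card_univ, nsmul_eq_mul, mul_one] at h2
  nlinarith [mul_le_mul_of_nonneg_left h2 hθ0]

/-! ### Subadditivity of entropy -/

theorem log_sum_two {a s a' s' p q : ℝ} (ha : 0 < a) (hs : 0 < s) (ha' : 0 < a') (hs' : 0 < s')
    (hp : 0 < p) (hq : 0 < q) :
    (p * a + q * a') * Real.log ((p * a + q * a') / (p * s + q * s'))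
      ≤ p * (a * Real.log (a / s)) + q * (a' * Real.log (a' / s')) := by
  have hA : 0 < p * a + q * a' := by positivity
  have hS : 0 < p * s + q * s' := by positivity
  set A := p * a + q * a' with hAdef
  set S := p * s + q * s' with hSdef
  have key : ∀ x y : ℝ, 0 < x → 0 < y →
      x * Real.log (A / S) + x - y * (A / S) ≤ x * Real.log (x / y) := by
    intro x y hx hy
    have h := Real.log_le_sub_one_of_pos (x := (A / S) / (x / y)) (by positivity)
    rw [Real.log_div (by positivity) (by positivity)] at h
    have h' := mul_le_mul_of_nonneg_left h hx.le
    have e : x * (A / S / (x / y) - 1) = y * (A / S) - x := by field_simp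
    rw [e] at h'
    linarith
  have k1 := mul_le_mul_of_nonneg_left (key a s ha hs) hp.le
  have k2 := mul_le_mul_of_nonneg_left (key a' s' ha' hs') hq.le
  have e : (p * s + q * s') * (A / S) = A := by
    rw [← hSdef]; field_simp
  nlinarith

theorem avgAt_pos [DecidableEq ι]
    {δ : ℝ} (h0 : 0 < δ) (h1 : δ < 1) {f : (ι → ZMod 2) → ℝ} (hf : ∀ z, 0 < f z)
    (i : ι) (z : ι → ZMod 2) : 0 < avgAt δ i f z := by
  have h1' : 0 < 1 - δ := by linarith
  have := hf (Function.update z i 0)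
  have := hf (Function.update z i 1)
  simp only [avgAt]
  positivity

theorem avgList_pos [DecidableEq ι] {δ : ℝ} (h0 : 0 < δ) (h1 : δ < 1) {f : (ι → ZMod 2) → ℝ}
    (hf : ∀ z, 0 < f z) (l : List ι) (z : ι → ZMod 2) : 0 < avgList δ l f z := by
  induction l generalizing z with
  | nil => exact hf z
  | cons i l ih => exact avgAt_pos h0 h1 ih i z

/-- The entropy of `f` along the coordinate `i`. -/
noncomputable def entAt [Fintype ι] [DecidableEq ι] (δ : ℝ) (i : ι) (f : (ι → ZMod 2) → ℝ) : ℝ :=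
  cubeMean δ (fun z => f z * Real.log (f z / avgAt δ i f z))

theorem entAt_avgAt_le [Fintype ι] [DecidableEq ι]
    {δ : ℝ} (h0 : 0 < δ) (h1 : δ < 1) {f : (ι → ZMod 2) → ℝ}
    (hf : ∀ z, 0 < f z) (i j : ι) : entAt δ i (avgAt δ j f) ≤ entAt δ i f := by
  rw [entAt, entAt, avgAt_comm,
    ← cubeMean_avgAt δ j (fun z => f z * Real.log (f z / avgAt δ i f z))]
  refine cubeMean_mono h0.le h1.le fun z => ?_
  exact log_sum_two (hf _) (avgAt_pos h0 h1 hf i _) (hf _) (avgAt_pos h0 h1 hf i _)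
    (by linarith) h0

theorem entAt_avgList_le [Fintype ι] [DecidableEq ι]
    {δ : ℝ} (h0 : 0 < δ) (h1 : δ < 1) {f : (ι → ZMod 2) → ℝ}
    (hf : ∀ z, 0 < f z) (i : ι) (l : List ι) : entAt δ i (avgList δ l f) ≤ entAt δ i f := by
  induction l with
  | nil => exact le_rfl
  | cons j l ih => exact (entAt_avgAt_le h0 h1 (avgList_pos h0 h1 hf l) i j).trans ih

theorem entAt_eq_sub [Fintype ι] [DecidableEq ι]
    {δ : ℝ} (h0 : 0 < δ) (h1 : δ < 1) {f : (ι → ZMod 2) → ℝ}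
    (hf : ∀ z, 0 < f z) (i : ι) :
    entAt δ i f = cubeMean δ (fun z => f z * Real.log (f z))
      - cubeMean δ (fun z => avgAt δ i f z * Real.log (avgAt δ i f z)) := by
  have hind : IndepAt i (fun z => Real.log (avgAt δ i f z)) := fun z b => by
    simp only [indepAt_avgAt_self δ i f z b]
  have h := cubeMean_avgAt_mul δ i f (fun z => Real.log (avgAt δ i f z))
  rw [avgAt_of_indepAt hind] at h
  rw [h, ← cubeMean_sub, entAt]
  congr 1
  funext z
  rw [Real.log_div (hf z).ne' (avgAt_pos h0 h1 hf i z).ne', mul_sub]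

theorem entropy_sub_avgList_le [Fintype ι] [DecidableEq ι]
    {δ : ℝ} (h0 : 0 < δ) (h1 : δ < 1) {f : (ι → ZMod 2) → ℝ}
    (hf : ∀ z, 0 < f z) (l : List ι) :
    cubeMean δ (fun z => f z * Real.log (f z))
        - cubeMean δ (fun z => avgList δ l f z * Real.log (avgList δ l f z))
      ≤ (l.map fun i => entAt δ i f).sum := by
  induction l with
  | nil => simp [avgList]
  | cons i l ih =>
    have h := entAt_avgList_le h0 h1 hf i l
    rw [entAt_eq_sub h0 h1 (avgList_pos h0 h1 hf l)] at h
    have hc : avgList δ (i :: l) f = avgAt δ i (avgList δ l f) := rfl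
    rw [hc, List.map_cons, List.sum_cons]
    linarith

/-- Subadditivity of entropy under a product law. -/
theorem entropy_le_sum_entAt [Fintype ι] [DecidableEq ι]
    {δ : ℝ} (h0 : 0 < δ) (h1 : δ < 1) {f : (ι → ZMod 2) → ℝ}
    (hf : ∀ z, 0 < f z) :
    cubeMean δ (fun z => f z * Real.log (f z)) - cubeMean δ f * Real.log (cubeMean δ f)
      ≤ ∑ i, entAt δ i f := by
  have h := entropy_sub_avgList_le h0 h1 hf Finset.univ.toList
  simpa only [avgList_univ, cubeMean_const, Finset.sum_map_toList] using h

/-! ### Noisy codewords of an additive code -/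

theorem avgAt_half [DecidableEq ι] (i : ι) (f : (ι → ZMod 2) → ℝ) (z : ι → ZMod 2) :
    avgAt (1 / 2) i f z = (f z + f (z + Pi.single i 1)) / 2 := by
  rw [← update_zero_add_update_one, avgAt]
  ring

theorem cubeWeight_half [Fintype ι] (z : ι → ZMod 2) :
    cubeWeight (1 / 2) z = (1 / 2 : ℝ) ^ Fintype.card ι := by
  have : ∀ b, bitWeight (1 / 2) b = 1 / 2 := fun b => by
    rw [bitWeight]
    split_ifs <;> norm_num
  simp only [cubeWeight, this, Finset.prod_const, Finset.card_univ]

theorem cubeMean_half [Fintype ι] [DecidableEq ι] (f : (ι → ZMod 2) → ℝ) :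
    cubeMean (1 / 2) f = (1 / 2 : ℝ) ^ Fintype.card ι * ∑ z, f z := by
  simp only [cubeMean, cubeWeight_half, Finset.mul_sum]

/-- The conditional bias of the bit `i` given all the other bits, for the unnormalised law `Q`. -/
noncomputable def bias [DecidableEq ι] (Q : (ι → ZMod 2) → ℝ) (i : ι) (z : ι → ZMod 2) : ℝ :=
  (Q z - Q (z + Pi.single i 1)) / (Q z + Q (z + Pi.single i 1))

/-- The entropy deficit of a positive law on the cube is controlled by its conditional biases. -/
theorem entropy_deficit_le_sum_bias [Fintype ι] [DecidableEq ι]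
    {Q : (ι → ZMod 2) → ℝ} (hQ : ∀ z, 0 < Q z)
    (hsum : ∑ z, Q z = 1) :
    Fintype.card ι * Real.log 2 + ∑ z, Q z * Real.log (Q z) ≤ ∑ i, ∑ z, Q z * bias Q i z := by
  have h := entropy_le_sum_entAt (δ := 1 / 2) (by norm_num) (by norm_num) hQ
  simp only [entAt, cubeMean_half, hsum, mul_one, ← Finset.mul_sum] at h
  rw [← mul_sub] at h
  have h' := le_of_mul_le_mul_left h (by positivity)
  rw [Real.log_pow, one_div, Real.log_inv] at h'
  refine le_trans (by linarith) (h'.trans (Finset.sum_le_sum fun i _ => Finset.sum_le_sum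
    fun z _ => mul_le_mul_of_nonneg_left ?_ (hQ z).le))
  have hz := hQ z
  have hz' := hQ (z + Pi.single i 1)
  rw [← one_div, avgAt_half]
  refine (Real.log_le_sub_one_of_pos (by positivity)).trans (le_of_eq ?_)
  rw [bias]
  field_simp
  ring

section Code

variable (C : AddSubgroup (ι → ZMod 2)) [Fintype C]

/-- The law of a uniformly random codeword of `C` plus Bernoulli(`δ`) noise. -/
noncomputable def noisyLaw [Fintype ι] (δ : ℝ) (z : ι → ZMod 2) : ℝ :=
  (Fintype.card C : ℝ)⁻¹ * ∑ c : C, cubeWeight δ (z + c.1)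

theorem card_code_pos : (0 : ℝ) < Fintype.card C := by
  exact_mod_cast Fintype.card_pos

variable {C}

theorem noisyLaw_pos [Fintype ι] {δ : ℝ} (h0 : 0 < δ) (h1 : δ < 1) (z : ι → ZMod 2) :
    0 < noisyLaw C δ z :=
  mul_pos (inv_pos.2 (card_code_pos C))
    (Finset.sum_pos (fun _ _ => cubeWeight_pos h0 h1 _) Finset.univ_nonempty)

theorem noisyLaw_add [Fintype ι] (δ : ℝ) {c : ι → ZMod 2} (hc : c ∈ C) (z : ι → ZMod 2) :
    noisyLaw C δ (z + c) = noisyLaw C δ z := by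
  rw [noisyLaw, noisyLaw]
  congr 1
  exact Fintype.sum_equiv (Equiv.addLeft (⟨c, hc⟩ : C)) _ _ fun x => by simp [add_assoc]

theorem sum_noisyLaw_mul [Fintype ι] [DecidableEq ι]
    (δ : ℝ) {h : (ι → ZMod 2) → ℝ} (hh : ∀ c ∈ C, ∀ z, h (z + c) = h z) :
    ∑ z, noisyLaw C δ z * h z = cubeMean δ h := by
  have key : ∀ c : C, ∑ z, cubeWeight δ (z + c.1) * h z = cubeMean δ h := fun c => by
    rw [cubeMean]
    refine Fintype.sum_equiv (Equiv.addRight c.1) _ _ fun z => ?_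
    simp [hh c.1 c.2 z]
  have hcard := card_code_pos C
  simp only [noisyLaw, mul_assoc, Finset.sum_mul, ← Finset.mul_sum]
  rw [Finset.sum_comm]
  simp only [key, Finset.sum_const, Finset.card_univ, nsmul_eq_mul]
  field_simp

theorem sum_noisyLaw [Fintype ι] [DecidableEq ι] (δ : ℝ) : ∑ z, noisyLaw C δ z = 1 := by
  simpa [cubeMean_const] using sum_noisyLaw_mul (C := C) δ (h := fun _ => 1) fun _ _ _ => rfl

theorem cubeMean_log_cubeWeight [Fintype ι] [DecidableEq ι] {δ : ℝ} (h0 : 0 < δ) (h1 : δ < 1) :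
    cubeMean δ (fun z : ι → ZMod 2 => Real.log (cubeWeight δ z))
      = Fintype.card ι * (δ * Real.log δ + (1 - δ) * Real.log (1 - δ)) := by
  have hlog : ∀ z : ι → ZMod 2,
      Real.log (cubeWeight δ z) = ∑ i, Real.log (bitWeight δ (z i)) := fun z => by
    rw [cubeWeight, Real.log_prod]
    intro i _
    rw [bitWeight]
    split_ifs <;> linarith
  simp only [hlog, cubeMean_sum]
  rw [← nsmul_eq_mul, ← Finset.card_univ, ← Finset.sum_const]
  refine Finset.sum_congr rfl fun i _ => ?_
  rw [← cubeMean_avgAt δ i]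
  convert cubeMean_const (ι := ι) δ (δ * Real.log δ + (1 - δ) * Real.log (1 - δ)) using 2
  funext z
  simp [avgAt, bitWeight]
  ring

theorem log_two_mul_Hbin (δ : ℝ) :
    Real.log 2 * Hbin δ = -(δ * Real.log δ + (1 - δ) * Real.log (1 - δ)) := by
  have : Real.log 2 ≠ 0 := (Real.log_pos one_lt_two).ne'
  rw [Hbin, Real.logb, Real.logb]
  field_simp
  ring

/-- The entropy of a noisy codeword is at most the entropy of the codeword plus that of the
noise. -/
theorem sum_noisyLaw_mul_log_ge [Fintype ι] [DecidableEq ι] {δ : ℝ} (h0 : 0 < δ) (h1 : δ < 1) :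
    -(Fintype.card ι * (Real.log 2 * Hbin δ)) - Real.log (Fintype.card C)
      ≤ ∑ z, noisyLaw C δ z * Real.log (noisyLaw C δ z) := by
  have hcard := card_code_pos C
  rw [sum_noisyLaw_mul δ fun c hc z => by rw [noisyLaw_add δ hc], log_two_mul_Hbin, mul_neg,
    neg_neg, ← cubeMean_log_cubeWeight h0 h1, ← cubeMean_const (ι := ι) δ (Real.log _),
    ← cubeMean_sub]
  refine cubeMean_mono h0.le h1.le fun z => ?_
  rw [← Real.log_div (cubeWeight_pos h0 h1 z).ne' hcard.ne']
  refine Real.log_le_log (div_pos (cubeWeight_pos h0 h1 z) hcard) ?_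
  rw [noisyLaw, div_eq_inv_mul]
  refine mul_le_mul_of_nonneg_left ?_ (inv_pos.2 hcard).le
  have := Finset.single_le_sum (f := fun c : C => cubeWeight δ (z + c.1))
    (fun c _ => cubeWeight_nonneg h0.le h1.le _) (Finset.mem_univ 0)
  simpa using this

/-! ### The extrinsic estimator of a codeword bit -/

/-- The sign `(-1) ^ b` of a bit. -/
noncomputable def bitSign (b : ZMod 2) : ℝ := if b = 1 then -1 else 1

theorem bitSign_add (a b : ZMod 2) : bitSign (a + b) = bitSign a * bitSign b := by
  rcases zmod_two_cases a with rfl | rfl <;> rcases zmod_two_cases b with rfl | rfl <;>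
    simp [bitSign, show (1 : ZMod 2) + 1 = 0 from rfl]

theorem abs_bitSign (b : ZMod 2) : |bitSign b| = 1 := by
  rw [bitSign]
  split_ifs <;> simp

theorem bitSign_mul_self (b : ZMod 2) : bitSign b * bitSign b = 1 := by
  rw [bitSign]
  split_ifs <;> simp

variable (C) in
/-- The estimator of the `i`-th bit (as a sign) of a codeword of `C` from the other noisy bits. -/
noncomputable def estimator [Fintype ι] [DecidableEq ι] (δ : ℝ) (i : ι) (z : ι → ZMod 2) : ℝ :=
  bitSign (z i) * bias (noisyLaw C δ) i z

theorem bias_noisyLaw_add [Fintype ι] [DecidableEq ι]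
    (δ : ℝ) (i : ι) {c : ι → ZMod 2} (hc : c ∈ C) (z : ι → ZMod 2) :
    bias (noisyLaw C δ) i (z + c) = bias (noisyLaw C δ) i z := by
  rw [bias, bias, add_right_comm, noisyLaw_add δ hc, noisyLaw_add δ hc]

theorem estimator_add [Fintype ι] [DecidableEq ι]
    (δ : ℝ) (i : ι) {c : ι → ZMod 2} (hc : c ∈ C) (z : ι → ZMod 2) :
    estimator C δ i (z + c) = bitSign (c i) * estimator C δ i z := by
  rw [estimator, estimator, bias_noisyLaw_add δ i hc, Pi.add_apply, bitSign_add]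
  ring

theorem abs_estimator_le [Fintype ι] [DecidableEq ι]
    {δ : ℝ} (h0 : 0 < δ) (h1 : δ < 1) (i : ι) (z : ι → ZMod 2) :
    |estimator C δ i z| ≤ 1 := by
  have hz := noisyLaw_pos (C := C) h0 h1 z
  have hz' := noisyLaw_pos (C := C) h0 h1 (z + Pi.single i 1)
  rw [estimator, abs_mul, abs_bitSign, one_mul, bias, abs_div, abs_of_pos (add_pos hz hz'),
    div_le_one (add_pos hz hz'), abs_le]
  constructor <;> linarith

theorem add_single_add_single [DecidableEq ι] (i : ι) (z : ι → ZMod 2) :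
    z + Pi.single i 1 + Pi.single i 1 = z := by
  rw [add_assoc, ← Pi.single_add, show (1 : ZMod 2) + 1 = 0 from rfl, Pi.single_zero, add_zero]

theorem estimator_add_single [Fintype ι] [DecidableEq ι] (δ : ℝ) (i : ι) (z : ι → ZMod 2) :
    estimator C δ i (z + Pi.single i 1) = estimator C δ i z := by
  rw [estimator, estimator, Pi.add_apply, bitSign_add, bias, bias, add_single_add_single,
    Pi.single_eq_same, ← neg_sub (noisyLaw C δ z), add_comm (noisyLaw C δ (z + _)), neg_div]
  simp [bitSign]

theorem indepAt_of_add_single [DecidableEq ι] {i : ι} {f : (ι → ZMod 2) → ℝ}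
    (h : ∀ z, f (z + Pi.single i 1) = f z) : IndepAt i f := by
  intro z b
  have key : Function.update z i b = z ∨ Function.update z i b = z + Pi.single i 1 := by
    by_cases hb : b = z i
    · left
      rw [hb, Function.update_eq_self]
    · right
      have hb' : b = z i + 1 := by
        rcases zmod_two_cases b with rfl | rfl <;> rcases zmod_two_cases (z i) with h | h <;>
          (simp_all; try rfl)
      funext j
      by_cases hj : j = i
      · subst hj; simp [hb']
      · simp [hj]
  rcases key with e | e <;> rw [e]
  exact h z

theorem cubeMean_bitSign_mul [Fintype ι] [DecidableEq ι]
    {δ : ℝ} {i : ι} {f : (ι → ZMod 2) → ℝ} (hf : IndepAt i f) :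
    cubeMean δ (fun z => bitSign (z i) * f z) = (1 - 2 * δ) * cubeMean δ f := by
  rw [← cubeMean_avgAt δ i, ← cubeMean_const_mul]
  congr 1
  funext z
  simp [avgAt, bitSign, hf z]
  ring

/-- The mean of the estimator is at least the mean conditional bias. -/
theorem sum_noisyLaw_mul_bias_le [Fintype ι] [DecidableEq ι]
    {δ : ℝ} (h0 : 0 < δ) (h1 : δ < 1 / 2) (i : ι)
    (hnonneg : 0 ≤ ∑ z, noisyLaw C δ z * bias (noisyLaw C δ) i z) :
    ∑ z, noisyLaw C δ z * bias (noisyLaw C δ) i z ≤ cubeMean δ (estimator C δ i) := by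
  have e : ∑ z, noisyLaw C δ z * bias (noisyLaw C δ) i z
      = (1 - 2 * δ) * cubeMean δ (estimator C δ i) := by
    rw [sum_noisyLaw_mul δ fun c hc z => bias_noisyLaw_add δ i hc z,
      ← cubeMean_bitSign_mul (indepAt_of_add_single (estimator_add_single δ i))]
    simp only [estimator, ← mul_assoc, bitSign_mul_self, one_mul]
  rw [e] at hnonneg ⊢
  have : 0 ≤ cubeMean δ (estimator C δ i) := nonneg_of_mul_nonneg_right hnonneg (by linarith)
  nlinarith

/-- For a code whose noisy law is invariant under a transitive family of permutations, the
estimator is nontrivial as soon as the rate is below capacity. -/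
theorem le_cubeMean_estimator [Fintype ι] [DecidableEq ι]
    {δ : ℝ} (h0 : 0 < δ) (h1 : δ < 1 / 2) (i₀ : ι)
    (hsymm : ∀ i, ∃ σ : Equiv.Perm ι, σ i₀ = i ∧ ∀ c ∈ C, c ∘ σ ∈ C)
    (hrate : Real.log (Fintype.card C) ≤ Fintype.card ι * (Real.log 2 * (1 - Hbin δ))) :
    Real.log 2 * (1 - Hbin δ) - Real.log (Fintype.card C) / Fintype.card ι
      ≤ cubeMean δ (estimator C δ i₀) := by
  have hn : (0 : ℝ) < Fintype.card ι := by exact_mod_cast Fintype.card_pos_iff.2 ⟨i₀⟩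
  have hS : ∀ i, ∑ z, noisyLaw C δ z * bias (noisyLaw C δ) i z
      = ∑ z, noisyLaw C δ z * bias (noisyLaw C δ) i₀ z := by
    intro i
    obtain ⟨σ, hσ, hC⟩ := hsymm i
    have hw : ∀ z : ι → ZMod 2, cubeWeight δ (z ∘ σ) = cubeWeight δ z := fun z =>
      Equiv.prod_comp σ fun j => bitWeight δ (z j)
    have hinj : Function.Injective (fun c : C => (⟨c.1 ∘ σ, hC c.1 c.2⟩ : C)) := by
      intro c c' h
      have h' : c.1 ∘ σ = c'.1 ∘ σ := congrArg Subtype.val h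
      exact Subtype.ext (σ.surjective.injective_comp_right h')
    have hQ : ∀ z, noisyLaw C δ (z ∘ σ) = noisyLaw C δ z := by
      intro z
      rw [noisyLaw, noisyLaw]
      congr 1
      refine (Fintype.sum_bijective _ (Finite.injective_iff_bijective.1 hinj) _ _ fun c => ?_).symm
      rw [← hw (z + c.1)]
      rfl
    have hs : ∀ z : ι → ZMod 2, (z + Pi.single i 1) ∘ σ = z ∘ σ + Pi.single i₀ 1 := by
      intro z
      funext j
      simp only [Function.comp_apply, Pi.add_apply, Pi.single_apply, ← hσ, σ.apply_eq_iff_eq]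
    refine Fintype.sum_equiv (σ.arrowCongr (Equiv.refl _)).symm _ _ fun z => ?_
    have e : (σ.arrowCongr (Equiv.refl (ZMod 2))).symm z = z ∘ σ := rfl
    rw [e, hQ, bias, bias, ← hs, hQ, hQ]
  have h := entropy_deficit_le_sum_bias (noisyLaw_pos (C := C) h0 (by linarith : δ < 1))
    (sum_noisyLaw δ)
  have h2 := sum_noisyLaw_mul_log_ge (C := C) h0 (by linarith : δ < 1)
  simp only [hS, Finset.sum_const, Finset.card_univ, nsmul_eq_mul] at h
  have h3 : Real.log 2 * (1 - Hbin δ) - Real.log (Fintype.card C) / Fintype.card ι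
      ≤ ∑ z, noisyLaw C δ z * bias (noisyLaw C δ) i₀ z := by
    rw [← mul_le_mul_iff_of_pos_left hn]
    have : Fintype.card ι * (Real.log (Fintype.card C) / Fintype.card ι)
        = Real.log (Fintype.card C) := by field_simp
    rw [mul_sub, this]
    linarith
  refine h3.trans (sum_noisyLaw_mul_bias_le h0 h1 i₀ (le_trans ?_ h3))
  rw [sub_nonneg, div_le_iff₀ hn]
  linarith

end Code

end Cube

/-! ### Reed–Muller codes -/

theorem Gmat_mul_self (m : ℕ) : Gmat m * Gmat m = 1 := by
  have hb : ∀ a c : ZMod 2, ∑ b, base a b * base b c = if a = c then 1 else 0 := by decide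
  ext x y
  have h := Finset.prod_univ_sum (fun _ : Fin m => (Finset.univ : Finset (ZMod 2)))
    (fun i b => base (x i) b * base b (y i))
  rw [Fintype.piFinset_univ] at h
  simp only [Matrix.mul_apply, Gmat, ← Finset.prod_mul_distrib]
  rw [← h]
  simp only [hb, Matrix.one_apply, Finset.prod_ite_zero, Finset.prod_const_one, funext_iff,
    Finset.mem_univ, true_implies]

theorem Wfun_Wfun (m : ℕ) (z : Idx m → ZMod 2) : Wfun m (Wfun m z) = z := by
  rw [Wfun, Wfun, Matrix.mulVec_mulVec, Gmat_mul_self, Matrix.one_mulVec]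

theorem Wfun_add (m : ℕ) (z w : Idx m → ZMod 2) : Wfun m (z + w) = Wfun m z + Wfun m w :=
  Matrix.mulVec_add _ _ _

/-- The Reed–Muller code of functions of degree at most `r` in `m` variables. -/
def reedMuller (m r : ℕ) : AddSubgroup (Idx m → ZMod 2) where
  carrier := {z | ∀ x, r < wt x → Wfun m z x = 0}
  zero_mem' := fun x _ => by simp [Wfun]
  add_mem' := fun {a b} ha hb x hx => by
    rw [Wfun_add, Pi.add_apply, ha x hx, hb x hx, add_zero]
  neg_mem' := fun {a} ha x hx => by
    rw [Wfun, Matrix.mulVec_neg, Pi.neg_apply, ← Wfun, ha x hx, neg_zero]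

noncomputable instance (m r : ℕ) : Fintype (reedMuller m r) := Fintype.ofFinite _

theorem reedMuller_mono {m r s : ℕ} (h : r ≤ s) : reedMuller m r ≤ reedMuller m s :=
  fun _ hz x hx => hz x (h.trans_lt hx)

theorem const_mem_reedMuller (m r : ℕ) (a : ZMod 2) : (fun _ => a) ∈ reedMuller m r := by
  have hb : ∀ b : ZMod 2, base b 0 = 1 := by decide
  have h1 : (fun _ : Idx m => a) = a • (Gmat m).col 0 := by
    funext x
    simp [Gmat, hb]
  intro x hx
  have hx0 : x ≠ 0 := by
    rintro rfl
    simp [wt] at hx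
  have h2 : (Gmat m).mulVec ((Gmat m).col 0) x = (Gmat m * Gmat m) x 0 := rfl
  rw [h1, Wfun, Matrix.mulVec_smul, Pi.smul_apply, h2, Gmat_mul_self, Matrix.one_apply_ne hx0,
    smul_zero]

theorem wt_update_zero {m : ℕ} {v : Idx m} {j : Fin m} (hj : v j = 1) :
    wt (Function.update v j 0) + 1 = wt v := by
  have : Finset.univ.filter (fun i => Function.update v j 0 i = 1)
      = (Finset.univ.filter (fun i => v i = 1)).erase j := by
    ext i
    by_cases hi : i = j
    · subst hi; simp
    · simp [hi]
  rw [wt, this, wt, Finset.card_erase_add_one (by simp [hj])]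

theorem Gmat_mul_coord {m : ℕ} (v u : Idx m) (j : Fin m) :
    Gmat m v u * u j = if v j = 1 then Gmat m v u + Gmat m (Function.update v j 0) u else 0 := by
  have hb : ∀ a b : ZMod 2, base a b * b = if a = 1 then base a b + base 0 b else 0 := by decide
  rw [Gmat, Gmat, ← Finset.mul_prod_erase _ _ (Finset.mem_univ j),
    ← Finset.mul_prod_erase _ (fun i => base (Function.update v j 0 i) (u i)) (Finset.mem_univ j),
    Function.update_self, mul_right_comm, hb]
  have : ∏ i ∈ Finset.univ.erase j, base (Function.update v j 0 i) (u i)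
      = ∏ i ∈ Finset.univ.erase j, base (v i) (u i) :=
    Finset.prod_congr rfl fun i hi => by rw [Function.update_of_ne (Finset.ne_of_mem_erase hi)]
  rw [this, ite_mul, zero_mul, add_mul]

theorem coord_mul_mem_reedMuller {m r : ℕ} {f : Idx m → ZMod 2} (hf : f ∈ reedMuller m r)
    (j : Fin m) : (fun u => u j * f u) ∈ reedMuller m (r + 1) := by
  intro v hv
  have e : Wfun m (fun u => u j * f u) v
      = if v j = 1 then Wfun m f v + Wfun m f (Function.update v j 0) else 0 := by
    simp only [Wfun, Matrix.mulVec, dotProduct, ← mul_assoc, Gmat_mul_coord]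
    split_ifs
    · rw [← Finset.sum_add_distrib]
      exact Finset.sum_congr rfl fun u _ => by ring
    · simp
  rw [e]
  split_ifs with hj
  · have := wt_update_zero hj
    rw [hf v (by omega), hf _ (by omega), add_zero]
  · rfl

theorem affine_mul_mem_reedMuller {m r : ℕ} {f : Idx m → ZMod 2} (hf : f ∈ reedMuller m r)
    (a : ZMod 2) (A : Fin m → ZMod 2) :
    (fun u => (a + ∑ j, A j * u j) * f u) ∈ reedMuller m (r + 1) := by
  have hsmul : ∀ {s : ℕ} {g : Idx m → ZMod 2} (b : ZMod 2), g ∈ reedMuller m s →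
      b • g ∈ reedMuller m s := by
    intro s g b hg
    rcases zmod_two_cases b with rfl | rfl
    · rw [zero_smul]; exact zero_mem _
    · rwa [one_smul]
  have e : (fun u => (a + ∑ j, A j * u j) * f u)
      = a • f + ∑ j, A j • (fun u : Idx m => u j * f u) := by
    funext u
    simp [add_mul, Finset.sum_mul, mul_assoc]
  rw [e]
  exact add_mem (hsmul a (reedMuller_mono (Nat.le_succ r) hf))
    (sum_mem fun j _ => hsmul (A j) (coord_mul_mem_reedMuller hf j))

/-- Reed–Muller codes are stable under pull-back by affine maps. -/
theorem comp_affine_mem_reedMuller {m m' r : ℕ} {z : Idx m → ZMod 2} (hz : z ∈ reedMuller m r)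
    {L : Idx m' → Idx m} (a : Idx m) (A : Matrix (Fin m) (Fin m') (ZMod 2))
    (hL : ∀ u i, L u i = a i + ∑ j, A i j * u j) : z ∘ L ∈ reedMuller m' r := by
  have hprod : ∀ s : Finset (Fin m), (fun u => ∏ i ∈ s, L u i) ∈ reedMuller m' s.card := by
    intro s
    induction s using Finset.induction_on with
    | empty => simpa using const_mem_reedMuller m' 0 1
    | insert i s hi ih =>
      simp only [Finset.prod_insert hi, Finset.card_insert_of_notMem hi, hL _ i]
      exact affine_mul_mem_reedMuller ih (a i) (A i)
  have hb : ∀ b c : ZMod 2, base b c = if c = 1 then b else 1 := by decide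
  have e : z ∘ L = ∑ x, Wfun m z x • fun u => ∏ i ∈ Finset.univ.filter (fun i => x i = 1), L u i := by
    funext u
    rw [Function.comp_apply, ← congrFun (Wfun_Wfun m z) (L u), Wfun]
    simp only [Matrix.mulVec, dotProduct, Gmat, hb, Finset.sum_apply, Pi.smul_apply, smul_eq_mul,
      Finset.prod_filter]
    exact Finset.sum_congr rfl fun x _ => mul_comm _ _
  rw [e]
  refine sum_mem fun x _ => ?_
  by_cases hx : r < wt x
  · rw [hz x hx, zero_smul]
    exact zero_mem _
  · rcases zmod_two_cases (Wfun m z x) with h | h <;> rw [h]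
    · rw [zero_smul]; exact zero_mem _
    · rw [one_smul]
      exact reedMuller_mono (not_lt.1 hx) (hprod _)

theorem card_wt_le (m r : ℕ) : Fintype.card {x : Idx m // wt x ≤ r} = binomLe m r := by
  let e : Idx m ≃ Finset (Fin m) :=
    { toFun := fun x => Finset.univ.filter fun i => x i = 1
      invFun := fun s i => if i ∈ s then 1 else 0
      left_inv := fun x => by
        funext i
        rcases zmod_two_cases (x i) with h | h <;> simp [h]
      right_inv := fun s => by
        ext i
        simp }
  have h : Fintype.card {x : Idx m // wt x ≤ r} = Fintype.card {s : Finset (Fin m) // s.card ≤ r} :=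
    Fintype.card_congr (e.subtypeEquiv fun x => Iff.rfl)
  rw [h, Fintype.card_subtype, binomLe]
  have hU : Finset.univ.filter (fun s : Finset (Fin m) => s.card ≤ r)
      = (Finset.range (r + 1)).biUnion fun i => Finset.powersetCard i Finset.univ := by
    ext s
    simp [Finset.mem_powersetCard]
  rw [hU, Finset.card_biUnion]
  · simp
  · intro i _ j _ hij
    exact Finset.pairwise_disjoint_powersetCard _ hij

theorem card_reedMuller_le (m r : ℕ) : Fintype.card (reedMuller m r) ≤ 2 ^ binomLe m r := by
  have hinj : Function.Injective (fun c : reedMuller m r => Wle m r c.1) := by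
    intro c c' h
    refine Subtype.ext ?_
    rw [← Wfun_Wfun m c.1, ← Wfun_Wfun m c'.1]
    congr 1
    funext x
    by_cases hx : r < wt x
    · rw [c.2 x hx, c'.2 x hx]
    · exact congrFun h ⟨x, not_lt.1 hx⟩
  refine (Fintype.card_le_of_injective _ hinj).trans (le_of_eq ?_)
  rw [Fintype.card_fun, ZMod.card, card_wt_le]

/-- Below capacity, the estimator of the bit at the origin has mean bounded away from zero. -/
theorem le_cubeMean_estimator_reedMuller {δ : ℝ} (h0 : 0 < δ) (h1 : δ < 1 / 2) (m r : ℕ)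
    (hrate : (binomLe m r : ℝ) / 2 ^ m ≤ 1 - Hbin δ) :
    Real.log 2 * (1 - Hbin δ - binomLe m r / 2 ^ m)
      ≤ cubeMean δ (estimator (reedMuller m r) δ 0) := by
  have hlog : (0 : ℝ) < Real.log 2 := Real.log_pos one_lt_two
  have hcard : (Fintype.card (Idx m) : ℝ) = 2 ^ m := by
    rw [Fintype.card_fun, ZMod.card, Fintype.card_fin]
    push_cast
    rfl
  have hC : Real.log (Fintype.card (reedMuller m r)) ≤ binomLe m r * Real.log 2 := by
    rw [← Real.log_pow]
    exact Real.log_le_log (card_code_pos _) (by exact_mod_cast card_reedMuller_le m r)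
  have h2 : (0 : ℝ) < 2 ^ m := by positivity
  refine le_trans ?_ (le_cubeMean_estimator h0 h1 (0 : Idx m) ?_ ?_)
  · rw [hcard, mul_sub]
    refine sub_le_sub_left ?_ _
    rw [div_le_iff₀ h2]
    refine hC.trans (le_of_eq ?_)
    field_simp
  · intro i
    refine ⟨Equiv.addLeft i, by simp, fun c hc => ?_⟩
    refine comp_affine_mem_reedMuller hc i 1 fun u j => ?_
    simp [Matrix.one_apply]
  · rw [hcard]
    rw [div_le_iff₀ h2] at hrate
    refine hC.trans ?_
    nlinarith

/-! ### Boosting along graphs of linear maps -/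

/-- The affine embedding `u ↦ x + (u, M u)`. -/
def graphMap {m k : ℕ} (x : Idx (m + k)) (M : Matrix (Fin k) (Fin m) (ZMod 2)) (u : Idx m) :
    Idx (m + k) := x + Fin.append u (M.mulVec u)

theorem append_injective {m k : ℕ} {u u' : Idx m} {v v' : Idx k}
    (h : Fin.append u v = Fin.append u' v') : u = u' ∧ v = v' := by
  constructor
  · funext i
    simpa using congrFun h (Fin.castAdd k i)
  · funext i
    simpa using congrFun h (Fin.natAdd m i)

theorem graphMap_injective {m k : ℕ} (x : Idx (m + k)) (M : Matrix (Fin k) (Fin m) (ZMod 2)) :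
    Function.Injective (graphMap x M) := fun _ _ h => (append_injective (add_left_cancel h)).1

theorem graphMap_zero {m k : ℕ} (x : Idx (m + k)) (M : Matrix (Fin k) (Fin m) (ZMod 2)) :
    graphMap x M 0 = x := by
  have : Fin.append (0 : Idx m) (0 : Idx k) = 0 := by
    funext i
    refine Fin.addCases (fun j => ?_) (fun j => ?_) i <;> simp
  rw [graphMap, Matrix.mulVec_zero, this, add_zero]

theorem comp_graphMap_mem_reedMuller {m k r : ℕ} {c : Idx (m + k) → ZMod 2}
    (hc : c ∈ reedMuller (m + k) r) (x : Idx (m + k)) (M : Matrix (Fin k) (Fin m) (ZMod 2)) :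
    c ∘ graphMap x M ∈ reedMuller m r := by
  refine comp_affine_mem_reedMuller hc x
    (Fin.addCases (fun i => Pi.single i 1) (fun i => M i)) fun u i => ?_
  rw [graphMap, Pi.add_apply]
  congr 1
  refine Fin.addCases (fun j => ?_) (fun j => ?_) i
  · simp [Pi.single_apply]
  · simp [Matrix.mulVec, dotProduct]

open Classical in
theorem card_graphMap_le {m k : ℕ} (x y : Idx (m + k)) :
    ((Finset.univ.filter fun M : Matrix (Fin k) (Fin m) (ZMod 2) =>
        ∃ u, u ≠ 0 ∧ graphMap x M u = y).card : ℝ)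
      ≤ (1 / 2) ^ k * Fintype.card (Matrix (Fin k) (Fin m) (ZMod 2)) := by
  set S := Finset.univ.filter fun M : Matrix (Fin k) (Fin m) (ZMod 2) =>
    ∃ u, u ≠ 0 ∧ graphMap x M u = y with hS
  suffices h : S.card * 2 ^ k ≤ Fintype.card (Matrix (Fin k) (Fin m) (ZMod 2)) by
    have h' : (S.card : ℝ) * 2 ^ k ≤ Fintype.card (Matrix (Fin k) (Fin m) (ZMod 2)) := by
      exact_mod_cast h
    rw [one_div, inv_pow, inv_mul_eq_div, le_div_iff₀ (by positivity)]
    exact h'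
  rcases S.eq_empty_or_nonempty with hE | ⟨M₀, hM₀⟩
  · simp [hE]
  obtain ⟨u, hu, hy⟩ := (Finset.mem_filter.1 hM₀).2
  obtain ⟨j, hj⟩ : ∃ j, u j = 1 := by
    by_contra hcon
    push Not at hcon
    exact hu (funext fun j => (zmod_two_cases (u j)).resolve_right (hcon j))
  have hmul : ∀ M ∈ S, M.mulVec u = M₀.mulVec u := by
    intro M hM
    obtain ⟨u', _, hy'⟩ := (Finset.mem_filter.1 hM).2
    have h := append_injective (add_left_cancel (hy'.trans hy.symm))
    rw [← h.2, h.1]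
  have hcard : S.card * 2 ^ k = (S ×ˢ (Finset.univ : Finset (Idx k))).card := by
    rw [Finset.card_product, Finset.card_univ, Fintype.card_fun, ZMod.card, Fintype.card_fin]
  rw [hcard, ← Finset.card_univ]
  refine Finset.card_le_card_of_injOn
    (fun q => q.1 + Matrix.vecMulVec q.2 (Pi.single j 1)) (fun _ _ => Finset.mem_coe.2 (Finset.mem_univ _)) ?_
  rintro ⟨M, w⟩ hq ⟨M', w'⟩ hq' h
  have hM := hmul M (Finset.mem_product.1 hq).1
  have hM' := hmul M' (Finset.mem_product.1 hq').1
  have hv : ∀ w : Idx k, (Matrix.vecMulVec w (Pi.single j 1)).mulVec u = w := fun w => by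
    funext i
    simp [Matrix.mulVec, dotProduct, Matrix.vecMulVec_apply, Pi.single_apply, hj]
  simp only at h
  have h' := congrArg (fun A => Matrix.mulVec A u) h
  simp only [Matrix.add_mulVec, hv, hM, hM', add_right_inj] at h'
  subst h'
  rw [add_right_cancel h]

theorem cubeMean_comp {ι κ : Type*} [Fintype ι] [DecidableEq ι] [Fintype κ] [DecidableEq κ]
    (δ : ℝ) {L : κ → ι} (hL : Function.Injective L) (f : (κ → ZMod 2) → ℝ) :
    cubeMean δ (fun z : ι → ZMod 2 => f (z ∘ L)) = cubeMean δ f := by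
  have key : ∀ w : κ → ZMod 2,
      ∑ z : ι → ZMod 2 with z ∘ L = w, cubeWeight δ z = cubeWeight δ w := by
    intro w
    classical
    let t : ι → Finset (ZMod 2) := fun i => Finset.univ.filter fun b => ∀ u, L u = i → b = w u
    have ht : Finset.univ.filter (fun z : ι → ZMod 2 => z ∘ L = w) = Fintype.piFinset t := by
      ext z
      simp only [Finset.mem_filter, Finset.mem_univ, true_and, Fintype.mem_piFinset, t, funext_iff,
        Function.comp_apply]
      exact ⟨fun h i u hu => hu ▸ h u, fun h u => h (L u) u rfl⟩
    have h := Finset.prod_univ_sum t (fun _ b => bitWeight δ b)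
    simp only [cubeWeight]
    rw [ht, ← h, ← Finset.prod_subset (Finset.subset_univ (Finset.univ.image L)),
      Finset.prod_image hL.injOn]
    · refine Finset.prod_congr rfl fun u _ => ?_
      have : t (L u) = {w u} := by
        ext b
        simp only [t, Finset.mem_filter, Finset.mem_univ, true_and, Finset.mem_singleton]
        exact ⟨fun h => h u rfl, fun h u' hu' => by rw [h, hL hu']⟩
      rw [this, Finset.sum_singleton]
    · intro i _ hi
      have : t i = {0, 1} := by
        ext b
        simp only [t, Finset.mem_filter, Finset.mem_univ, true_and, Finset.mem_insert,
          Finset.mem_singleton]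
        exact ⟨fun _ => zmod_two_cases b, fun _ u hu =>
          absurd (Finset.mem_image.2 ⟨u, Finset.mem_univ _, hu⟩) hi⟩
      rw [this, Finset.sum_pair zero_ne_one]
      simp [bitWeight]
  rw [cubeMean, ← Finset.sum_fiberwise (s := Finset.univ) (g := fun z : ι → ZMod 2 => z ∘ L),
    cubeMean]
  refine Finset.sum_congr rfl fun w _ => ?_
  rw [← key w, Finset.sum_mul]
  exact Finset.sum_congr rfl fun z hz => by rw [(Finset.mem_filter.1 hz).2]

/-- The aggregate of the estimators of the bit `x` over all graphs of linear maps through `x`. -/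
noncomputable def vote (δ : ℝ) {m k : ℕ} (r : ℕ) (x : Idx (m + k)) (z : Idx (m + k) → ZMod 2) : ℝ :=
  ∑ M : Matrix (Fin k) (Fin m) (ZMod 2), estimator (reedMuller m r) δ 0 (z ∘ graphMap x M)

theorem vote_add (δ : ℝ) {m k r : ℕ} (x : Idx (m + k)) (z : Idx (m + k) → ZMod 2)
    {c : Idx (m + k) → ZMod 2} (hc : c ∈ reedMuller (m + k) r) :
    vote δ r x (z + c) = bitSign (c x) * vote δ r x z := by
  rw [vote, vote, Finset.mul_sum]
  refine Finset.sum_congr rfl fun M _ => ?_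
  have h := estimator_add δ 0 (comp_graphMap_mem_reedMuller hc x M) (z ∘ graphMap x M)
  rw [Function.comp_apply, graphMap_zero] at h
  exact h

theorem indepAt_comp_graphMap {m k : ℕ} {f : (Idx m → ZMod 2) → ℝ} (hf : IndepAt 0 f)
    (x y : Idx (m + k)) (M : Matrix (Fin k) (Fin m) (ZMod 2))
    (hy : ¬ ∃ u, u ≠ 0 ∧ graphMap x M u = y) :
    IndepAt y (fun z => f (z ∘ graphMap x M)) := by
  intro z b
  simp only
  by_cases hr : y ∈ Set.range (graphMap x M)
  · obtain ⟨u, rfl⟩ := hr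
    have hu : u = 0 := by
      by_contra hu
      exact hy ⟨u, hu, rfl⟩
    rw [Function.update_comp_eq_of_injective z (graphMap_injective x M), hu, hf]
  · rw [Function.update_comp_eq_of_notMem_range z b (by simpa using hr)]

/-- The probability that the vote on a bit is wrong. -/
theorem cubeMean_vote_nonpos_le {δ : ℝ} (h0 : 0 < δ) (h1 : δ < 1 / 2) {m k r : ℕ}
    (x : Idx (m + k)) {μ : ℝ} (hμ : 0 < μ)
    (hmean : μ ≤ cubeMean δ (estimator (reedMuller m r) δ 0)) :
    cubeMean δ (fun z => if vote δ r x z ≤ 0 then 1 else 0) ≤ (1 / 2) ^ k / μ ^ 2 := by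
  classical
  set N : ℝ := ((Fintype.card (Matrix (Fin k) (Fin m) (ZMod 2)) : ℕ) : ℝ) with hN
  have hNpos : 0 < N := by
    rw [hN]
    exact_mod_cast Fintype.card_pos
  have hvar := variance_sum_le (δ := δ) (θ := (1 / 2) ^ k * N) h0.le (by linarith)
    (fun M z => estimator (reedMuller m r) δ 0 (z ∘ graphMap x M))
    (fun M y => ∃ u, u ≠ 0 ∧ graphMap x M u = y)
    (fun M y hy => indepAt_comp_graphMap (indepAt_of_add_single (estimator_add_single δ 0)) x y M hy)
    (fun M z => abs_estimator_le h0 (by linarith) 0 _) (by positivity)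
    (fun y => card_graphMap_le x y)
  simp only [cubeMean_comp δ (graphMap_injective x _), Finset.sum_const, Finset.card_univ,
    nsmul_eq_mul] at hvar
  set ν := cubeMean δ (estimator (reedMuller m r) δ 0)
  have hle : cubeMean δ (fun z => (N * μ) ^ 2 * if vote δ r x z ≤ 0 then 1 else 0)
      ≤ (1 / 2) ^ k * N * N := by
    refine le_trans (cubeMean_mono h0.le (by linarith) fun z => ?_) hvar
    change _ ≤ (vote δ r x z - N * ν) ^ 2
    have hNμ : 0 < N * μ := by positivity
    have hNν : N * μ ≤ N * ν := mul_le_mul_of_nonneg_left hmean hNpos.le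
    split_ifs with hv
    · nlinarith
    · simpa using sq_nonneg _
  rw [cubeMean_const_mul] at hle
  rw [le_div_iff₀ (by positivity)]
  have hN2 : 0 < N ^ 2 := by positivity
  refine le_of_mul_le_mul_left ?_ hN2
  linarith

/-- The decoder of the codeword bit `x` by the sign of the vote. -/
noncomputable def decoder (δ : ℝ) {m k : ℕ} (r : ℕ) (z : Idx (m + k) → ZMod 2) :
    Idx (m + k) → ZMod 2 :=
  fun x => if 0 < vote δ r x z then 0 else if vote δ r x z < 0 then 1 else z x

theorem decoder_add (δ : ℝ) {m k r : ℕ} (z : Idx (m + k) → ZMod 2)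
    {c : Idx (m + k) → ZMod 2} (hc : c ∈ reedMuller (m + k) r) :
    decoder δ r (z + c) = decoder δ r z + c := by
  funext x
  rw [Pi.add_apply, decoder, decoder, vote_add δ x z hc, Pi.add_apply]
  rcases zmod_two_cases (c x) with h | h <;> rw [h] <;>
    rcases lt_trichotomy (vote δ r x z) 0 with hv | hv | hv <;>
    (simp [bitSign, hv, hv.not_gt]; try rfl)

theorem cubeMean_decoder_le {δ : ℝ} (h0 : 0 < δ) (h1 : δ < 1 / 2) {m k r : ℕ}
    (x : Idx (m + k)) {μ : ℝ} (hμ : 0 < μ)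
    (hmean : μ ≤ cubeMean δ (estimator (reedMuller m r) δ 0)) :
    cubeMean δ (fun z => if decoder δ r z x = 1 then 1 else 0) ≤ (1 / 2) ^ k / μ ^ 2 := by
  refine le_trans (cubeMean_mono h0.le (by linarith) fun z => ?_)
    (cubeMean_vote_nonpos_le h0 h1 x hμ hmean)
  by_cases hv : vote δ r x z ≤ 0
  · rw [if_pos hv]
    split_ifs <;> norm_num
  · have : decoder δ r z x = 0 := by rw [decoder, if_pos (not_le.1 hv)]
    simp [this, hv]

/-! ### Conditional entropy -/

theorem bern2_singleton {δ : ℝ} (b : ZMod 2) :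
    bern2 δ {b} = ENNReal.ofReal (bitWeight δ b) := by
  rcases zmod_two_cases b with rfl | rfl <;> simp [bern2, bitWeight]

instance (δ : ℝ) : IsFiniteMeasure (bern2 δ) := by
  refine ⟨?_⟩
  simp [bern2]

theorem noise_singleton {δ : ℝ} (h0 : 0 ≤ δ) (h1 : δ ≤ 1) {m : ℕ} (z : Idx m → ZMod 2) :
    noise m δ {z} = ENNReal.ofReal (cubeWeight δ z) := by
  rw [noise, Measure.pi_singleton, cubeWeight, ENNReal.ofReal_prod_of_nonneg]
  · simp only [bern2_singleton]
  · intro i _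
    rw [bitWeight]
    split_ifs <;> linarith

open Classical in
theorem noise_preimage {δ : ℝ} (h0 : 0 ≤ δ) (h1 : δ ≤ 1) {m : ℕ} (A : Set (Idx m → ZMod 2)) :
    (noise m δ A).toReal = ∑ z with z ∈ A, cubeWeight δ z := by
  have hA : A = ((Finset.univ.filter (· ∈ A) : Finset (Idx m → ZMod 2)) : Set _) := by simp
  conv_lhs => rw [hA]
  rw [← sum_measure_singleton, ENNReal.toReal_sum]
  · refine Finset.sum_congr rfl fun z _ => ?_
    rw [noise_singleton h0 h1, ENNReal.toReal_ofReal (cubeWeight_nonneg h0 h1 z)]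
  · intro z _
    rw [noise_singleton h0 h1]
    exact ENNReal.ofReal_ne_top

theorem ent_noise {δ : ℝ} (h0 : 0 ≤ δ) (h1 : δ ≤ 1) {m : ℕ} {S : Type*} [Finite S]
    [DecidableEq S]
    (X : (Idx m → ZMod 2) → S) :
    ent (noise m δ) X = -cubeMean δ (fun z =>
      Real.logb 2 (∑ w with X w = X z, cubeWeight δ w)) := by
  have := Fintype.ofFinite S
  rw [ent, tsum_fintype, cubeMean,
    ← Finset.sum_fiberwise (s := Finset.univ) (g := X)]
  congr 1
  refine Finset.sum_congr rfl fun s _ => ?_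
  rw [noise_preimage h0 h1]
  simp only [Set.mem_preimage, Set.mem_singleton_iff]
  rw [Finset.sum_mul]
  exact Finset.sum_congr rfl fun z hz => by rw [(Finset.mem_filter.1 hz).2]

/-- If `φ` is injective on the fibres of `Y`, then the conditional entropy given `Y` is at most
the cost of encoding `φ` with a product Bernoulli(`η`) law. -/
theorem condEnt_le_cubeMean_logb {δ η : ℝ} (h0 : 0 < δ) (h1 : δ < 1) (hη0 : 0 < η) (hη1 : η < 1)
    {m : ℕ} {S T : Type*} [Finite S] [Finite T] (X : (Idx m → ZMod 2) → S)
    (Y : (Idx m → ZMod 2) → T) (φ : (Idx m → ZMod 2) → Idx m → ZMod 2)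
    (hφ : ∀ z w, Y z = Y w → φ z = φ w → z = w) :
    condEnt (noise m δ) X Y ≤ cubeMean δ (fun z => -Real.logb 2 (cubeWeight η (φ z))) := by
  classical
  have hlog : (0 : ℝ) < Real.log 2 := Real.log_pos one_lt_two
  rw [condEnt, ent_noise h0.le h1.le, ent_noise h0.le h1.le]
  set P : (Idx m → ZMod 2) → ℝ := fun z => ∑ w with Y w = Y z, cubeWeight δ w with hP
  have hPpos : ∀ z, 0 < P z := fun z =>
    Finset.sum_pos (fun w _ => cubeWeight_pos h0 h1 w) ⟨z, by simp⟩
  have hmass : ∑ z, P z * cubeWeight η (φ z) ≤ 1 := by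
    simp only [hP, Finset.sum_mul, Finset.sum_filter, ite_mul, zero_mul]
    rw [Finset.sum_comm, ← sum_cubeWeight (ι := Idx m) δ]
    refine Finset.sum_le_sum fun w _ => ?_
    have hinj : ∑ z with Y w = Y z, cubeWeight η (φ z) ≤ 1 := by
      rw [← Finset.sum_image (f := cubeWeight η) (g := φ), ← sum_cubeWeight (ι := Idx m) η]
      · exact Finset.sum_le_univ_sum_of_nonneg fun z => cubeWeight_nonneg hη0.le hη1.le z
      · intro z hz z' hz' h
        have hz := (Finset.mem_filter.1 hz).2
        have hz' := (Finset.mem_filter.1 hz').2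
        exact hφ z z' (hz.symm.trans hz') h
    rw [← Finset.sum_filter, ← Finset.mul_sum]
    exact mul_le_of_le_one_right (cubeWeight_nonneg h0.le h1.le w) hinj
  have hpoint : ∀ z, cubeWeight δ z * (-Real.logb 2 (∑ w with (X w, Y w) = (X z, Y z),
      cubeWeight δ w) + Real.logb 2 (P z) - -Real.logb 2 (cubeWeight η (φ z)))
      ≤ (P z * cubeWeight η (φ z) - cubeWeight δ z) / Real.log 2 := by
    intro z
    have hz := cubeWeight_pos h0 h1 z
    have hq := cubeWeight_pos hη0 hη1 (φ z)
    have hjoint : Real.logb 2 (cubeWeight δ z)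
        ≤ Real.logb 2 (∑ w with (X w, Y w) = (X z, Y z), cubeWeight δ w) :=
      Real.logb_le_logb_of_le one_lt_two hz
        (Finset.single_le_sum (f := cubeWeight δ) (fun w _ => cubeWeight_nonneg h0.le h1.le w)
          (by simp))
    have hratio : Real.logb 2 (P z) + Real.logb 2 (cubeWeight η (φ z))
        - Real.logb 2 (cubeWeight δ z)
        ≤ (P z * cubeWeight η (φ z) / cubeWeight δ z - 1) / Real.log 2 := by
      rw [← Real.logb_mul (hPpos z).ne' hq.ne', ← Real.logb_div (by have := hPpos z; positivity) hz.ne',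
        Real.logb]
      exact div_le_div_of_nonneg_right
        (Real.log_le_sub_one_of_pos (by have := hPpos z; positivity)) hlog.le
    calc _ ≤ cubeWeight δ z * ((P z * cubeWeight η (φ z) / cubeWeight δ z - 1) / Real.log 2) :=
          mul_le_mul_of_nonneg_left (by linarith) hz.le
      _ = _ := by field_simp
  have htotal := Finset.sum_le_sum fun z (_ : z ∈ Finset.univ) => hpoint z
  rw [← Finset.sum_div, Finset.sum_sub_distrib, sum_cubeWeight] at htotal
  have hneg : (∑ z, P z * cubeWeight η (φ z) - 1) / Real.log 2 ≤ 0 :=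
    div_nonpos_of_nonpos_of_nonneg (by linarith) hlog.le
  have hfin := htotal.trans hneg
  simp only [mul_sub, mul_add, mul_neg, Finset.sum_sub_distrib, Finset.sum_add_distrib,
    Finset.sum_neg_distrib, hP] at hfin
  simp only [cubeMean, mul_neg, Finset.sum_neg_distrib]
  linarith

theorem condEnt_reedMuller_le {δ : ℝ} (h0 : 0 < δ) (h1 : δ < 1 / 2) {m k r : ℕ} (hk : 1 ≤ k)
    {μ : ℝ} (hμ : 0 < μ) (hmean : μ ≤ cubeMean δ (estimator (reedMuller m r) δ 0)) :
    condEnt (noise (m + k) δ) (Wle (m + k) r) (Wgt (m + k) r)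
      ≤ 2 ^ (m + k) * ((1 / 2) ^ k * (k / μ ^ 2 + 4)) := by
  set η : ℝ := (1 / 2) ^ k with hη
  have hη0 : 0 < η := by positivity
  have hη2 : η ≤ 1 / 2 := by
    calc η ≤ (1 / 2 : ℝ) ^ 1 := pow_le_pow_of_le_one (by norm_num) (by norm_num) hk
      _ = 1 / 2 := pow_one _
  have hlogη : -Real.logb 2 η = k := by
    rw [hη, one_div, inv_pow, Real.logb_inv, neg_neg, Real.logb_pow]
    simp
  have hlog1 : -Real.logb 2 (1 - η) ≤ 4 * η := by
    have hl2 : (1 / 2 : ℝ) ≤ Real.log 2 := by linarith [Real.log_two_gt_d9]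
    have hl : -Real.log (1 - η) ≤ 2 * η := by
      have h := Real.one_sub_inv_le_log_of_pos (x := 1 - η) (by linarith)
      have h' : (1 - η)⁻¹ ≤ 1 + 2 * η := by
        rw [inv_le_iff_one_le_mul₀ (by linarith)]
        nlinarith
      linarith
    rw [Real.logb, ← neg_div, div_le_iff₀ (by linarith)]
    nlinarith
  have hinj : ∀ z w : Idx (m + k) → ZMod 2, Wgt (m + k) r z = Wgt (m + k) r w →
      decoder δ r z = decoder δ r w → z = w := by
    intro z w hY hφ
    have hmem : z - w ∈ reedMuller (m + k) r := by
      intro x hx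
      rw [Wfun, Matrix.mulVec_sub, Pi.sub_apply]
      exact sub_eq_zero.2 (congrFun hY ⟨x, hx⟩)
    have h := decoder_add δ w hmem
    rw [add_sub_cancel, hφ] at h
    exact sub_eq_zero.1 (left_eq_add.1 h)
  refine (condEnt_le_cubeMean_logb h0 (by linarith) hη0 (by linarith) _ _ _ hinj).trans ?_
  have hcost : ∀ z : Idx (m + k) → ZMod 2, -Real.logb 2 (cubeWeight η (decoder δ r z))
      ≤ ∑ x, (k * (if decoder δ r z x = 1 then 1 else 0) + 4 * η) := by
    intro z
    rw [cubeWeight, Real.logb_prod, ← Finset.sum_neg_distrib]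
    · refine Finset.sum_le_sum fun x _ => ?_
      rw [bitWeight]
      split_ifs
      · rw [hlogη]; linarith
      · simpa using hlog1
    · intro x _
      rw [bitWeight]
      split_ifs <;> linarith
  refine (cubeMean_mono h0.le (by linarith) hcost).trans ?_
  rw [cubeMean_sum]
  have hbit : ∀ x : Idx (m + k),
      cubeMean δ (fun z => (k : ℝ) * (if decoder δ r z x = 1 then 1 else 0) + 4 * η)
        ≤ η * (k / μ ^ 2 + 4) := by
    intro x
    rw [cubeMean_add, cubeMean_const_mul, cubeMean_const]
    have h := mul_le_mul_of_nonneg_left (cubeMean_decoder_le h0 h1 x hμ hmean) (Nat.cast_nonneg k)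
    calc _ ≤ (k : ℝ) * ((1 / 2) ^ k / μ ^ 2) + 4 * η := by linarith
      _ = _ := by rw [← hη]; ring
  refine (Finset.sum_le_sum fun x _ => hbit x).trans (le_of_eq ?_)
  rw [Finset.sum_const, Finset.card_univ, Fintype.card_fun, ZMod.card, Fintype.card_fin,
    nsmul_eq_mul]
  push_cast
  rfl

/-! ### Binomial estimates -/

theorem centralBinom_sq_mul_le (t : ℕ) : t.centralBinom ^ 2 * (2 * t + 1) ≤ 16 ^ t := by
  induction t with
  | zero => simp
  | succ t ih =>
    have h := Nat.succ_mul_centralBinom_succ t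
    have hpos : 0 < (t + 1) ^ 2 := by positivity
    refine Nat.le_of_mul_le_mul_left ?_ hpos
    calc (t + 1) ^ 2 * ((t + 1).centralBinom ^ 2 * (2 * (t + 1) + 1))
        = ((t + 1) * (t + 1).centralBinom) ^ 2 * (2 * t + 3) := by ring
      _ = t.centralBinom ^ 2 * (2 * t + 1) * (4 * ((2 * t + 1) * (2 * t + 3))) := by
          rw [h]; ring
      _ ≤ 16 ^ t * (4 * (4 * (t + 1) ^ 2)) := by
          refine Nat.mul_le_mul ih ?_
          nlinarith
      _ = (t + 1) ^ 2 * 16 ^ (t + 1) := by ring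

theorem choose_sq_mul_le (n r : ℕ) : n.choose r ^ 2 * (n + 1) ≤ 4 ^ n := by
  have hmid : n.choose r ^ 2 * (n + 1) ≤ n.choose (n / 2) ^ 2 * (n + 1) :=
    Nat.mul_le_mul_right _ (Nat.pow_le_pow_left (Nat.choose_le_middle r n) 2)
  refine hmid.trans ?_
  rcases Nat.even_or_odd' n with ⟨t, rfl | rfl⟩
  · have h := centralBinom_sq_mul_le t
    rw [Nat.centralBinom] at h
    rw [Nat.mul_div_cancel_left t two_pos, pow_mul]
    simpa using h
  · have h := centralBinom_sq_mul_le (t + 1)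
    have e : (t + 1).centralBinom = 2 * (2 * t + 1).choose t := by
      rw [Nat.centralBinom_eq_two_mul_choose, show 2 * (t + 1) = 2 * t + 1 + 1 by ring,
        Nat.choose_succ_succ, Nat.choose_symm_half]
      ring
    have hdiv : (2 * t + 1) / 2 = t := by omega
    rw [hdiv]
    rw [e] at h
    have e16 : (16 : ℕ) ^ (t + 1) = 4 * 4 ^ (2 * t + 1) := by
      rw [pow_succ (4 : ℕ) (2 * t), pow_mul]
      ring
    rw [e16] at h
    nlinarith

theorem choose_div_two_pow_le (n r : ℕ) : (n.choose r : ℝ) / 2 ^ n ≤ 1 / √(n + 1) := by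
  have h : ((n.choose r : ℝ)) ^ 2 * (n + 1) ≤ 4 ^ n := by exact_mod_cast choose_sq_mul_le n r
  have hs : (0 : ℝ) < √(n + 1) := Real.sqrt_pos.2 (by positivity)
  rw [div_le_div_iff₀ (by positivity) hs, one_mul]
  refine le_of_sq_le_sq ?_ (by positivity)
  rw [mul_pow, Real.sq_sqrt (by positivity), ← pow_mul, mul_comm n 2, pow_mul]
  norm_num
  exact h

/-- The rate of the Reed–Muller code of degree `r` in `m` variables. -/
noncomputable def rmRate (m r : ℕ) : ℝ := (binomLe m r : ℝ) / 2 ^ m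

theorem binomLe_succ_add (m r : ℕ) : binomLe (m + 1) r + m.choose r = 2 * binomLe m r := by
  induction r with
  | zero => simp [binomLe]
  | succ r ih =>
    have e : ∀ n, binomLe n (r + 1) = binomLe n r + n.choose (r + 1) := fun n =>
      Finset.sum_range_succ _ _
    have h : (m + 1).choose (r + 1) = m.choose r + m.choose (r + 1) := Nat.choose_succ_succ' _ _
    rw [e, e, h]
    omega

theorem rmRate_succ_ge (m r : ℕ) : rmRate m r - 1 / √(m + 1) ≤ rmRate (m + 1) r := by
  have h : (binomLe (m + 1) r : ℝ) + m.choose r = 2 * binomLe m r := by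
    exact_mod_cast binomLe_succ_add m r
  have e : rmRate (m + 1) r = rmRate m r - (m.choose r / 2 ^ m) / 2 := by
    rw [rmRate, rmRate, eq_sub_of_add_eq h, pow_succ]
    field_simp
  have h1 := choose_div_two_pow_le m r
  have h2 : (0 : ℝ) ≤ m.choose r / 2 ^ m := by positivity
  rw [e]
  linarith

theorem rmRate_add_ge (m k r : ℕ) : rmRate m r - k / √(m + 1) ≤ rmRate (m + k) r := by
  induction k with
  | zero => simp
  | succ k ih =>
    have h := rmRate_succ_ge (m + k) r
    have h2 : 1 / √(((m + k : ℕ) : ℝ) + 1) ≤ 1 / √(m + 1) := by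
      refine one_div_le_one_div_of_le (Real.sqrt_pos.2 (by positivity)) (Real.sqrt_le_sqrt ?_)
      push_cast
      linarith [Nat.cast_nonneg (α := ℝ) k]
    have e : ((k + 1 : ℕ) : ℝ) / √(m + 1) = k / √(m + 1) + 1 / √(m + 1) := by
      push_cast
      ring
    rw [e, ← add_assoc m k 1]
    linarith

theorem rmRate_le_one (m r : ℕ) : rmRate m r ≤ 1 := by
  rw [rmRate, div_le_one (by positivity), ← card_wt_le]
  have h := Fintype.card_subtype_le (fun x : Idx m => wt x ≤ r)
  rw [Fintype.card_fun, ZMod.card, Fintype.card_fin] at h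
  exact_mod_cast h

theorem exists_rmRate_near {m : ℕ} {R : ℝ} (hR : 1 / 2 ^ m ≤ R) (hR1 : R < 1) :
    ∃ r, rmRate m r ≤ R ∧ R - 1 / √(m + 1) ≤ rmRate m r := by
  classical
  have hex : ∃ r, R < rmRate m r := by
    refine ⟨m, ?_⟩
    rw [rmRate, binomLe, Nat.sum_range_choose]
    simpa using hR1
  have hfind := Nat.find_spec hex
  obtain ⟨r, hr⟩ : ∃ r, Nat.find hex = r + 1 := by
    refine Nat.exists_eq_succ_of_ne_zero fun h => ?_
    rw [h, rmRate] at hfind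
    simp only [binomLe, zero_add, Finset.sum_range_one, Nat.choose_zero_right, Nat.cast_one]
      at hfind
    linarith
  have hmin := Nat.find_min hex (m := r) (by omega)
  rw [hr] at hfind
  have e : rmRate m (r + 1) = rmRate m r + m.choose (r + 1) / 2 ^ m := by
    rw [rmRate, rmRate, binomLe, Finset.sum_range_succ, ← binomLe]
    push_cast
    ring
  refine ⟨r, not_lt.1 hmin, ?_⟩
  have := choose_div_two_pow_le m (r + 1)
  linarith

/-! ### Asymptotics -/

theorem Hbin_eq_binEntropy (δ : ℝ) : Hbin δ = Real.binEntropy δ / Real.log 2 := by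
  have hlog : Real.log 2 ≠ 0 := (Real.log_pos one_lt_two).ne'
  rw [eq_div_iff hlog, mul_comm, log_two_mul_Hbin, Real.binEntropy, Real.log_inv, Real.log_inv]
  ring

theorem Hbin_pos {δ : ℝ} (h0 : 0 < δ) (h1 : δ < 1) : 0 < Hbin δ := by
  rw [Hbin_eq_binEntropy]
  exact div_pos (Real.binEntropy_pos h0 h1) (Real.log_pos one_lt_two)

theorem Hbin_lt_one {δ : ℝ} (h1 : δ ≠ 1 / 2) : Hbin δ < 1 := by
  rw [Hbin_eq_binEntropy, div_lt_one (Real.log_pos one_lt_two)]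
  exact Real.binEntropy_lt_log_two.2 (by simpa using h1)

theorem linear_le_two_rpow {B y : ℝ} (hy1 : 1 ≤ y)
    (hy : 2 * (4 * B + 8) / Real.log 2 ^ 2 ≤ y) : 2 * (2 * y * B + 4) ≤ (2 : ℝ) ^ y := by
  have hlog : (0 : ℝ) < Real.log 2 := Real.log_pos one_lt_two
  rw [Real.rpow_def_of_pos two_pos]
  have h := Real.quadratic_le_exp_of_nonneg (x := Real.log 2 * y) (by positivity)
  rw [div_le_iff₀ (by positivity)] at hy
  have h2 : 0 ≤ Real.log 2 * y := by positivity
  nlinarith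

theorem half_pow_mul_le {B ε s : ℝ} {k : ℕ} (hB : 0 ≤ B) (hk : (k : ℝ) ≤ ε * s)
    (hk' : ε * s - 1 ≤ k) (hs1 : 1 ≤ ε / 2 * s)
    (hs : 2 * (4 * B + 8) / Real.log 2 ^ 2 ≤ ε / 2 * s) :
    (1 / 2) ^ k * (k * B + 4) ≤ (2 : ℝ) ^ (-(ε / 2 * s)) := by
  have h := linear_le_two_rpow hs1 hs
  have h1 : (1 / 2 : ℝ) ^ k ≤ 2 ^ (-(ε * s)) * 2 := by
    have e : (2 : ℝ) ^ (-(ε * s)) * 2 = 2 ^ (-(ε * s) + 1) := by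
      rw [Real.rpow_add two_pos, Real.rpow_one]
    rw [e, one_div, inv_pow, ← Real.rpow_natCast, ← Real.rpow_neg two_pos.le]
    exact Real.rpow_le_rpow_of_exponent_le one_le_two (by linarith)
  have h2 : (k * B + 4 : ℝ) ≤ 2 * (ε / 2 * s) * B + 4 := by nlinarith
  have hpos : (0 : ℝ) < 2 ^ (-(ε * s)) := by positivity
  calc (1 / 2 : ℝ) ^ k * (k * B + 4)
      ≤ (2 ^ (-(ε * s)) * 2) * (2 * (ε / 2 * s) * B + 4) :=
        mul_le_mul h1 h2 (by positivity) (by positivity)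
    _ = 2 ^ (-(ε * s)) * (2 * (2 * (ε / 2 * s) * B + 4)) := by ring
    _ ≤ 2 ^ (-(ε * s)) * 2 ^ (ε / 2 * s) := mul_le_mul_of_nonneg_left h hpos.le
    _ = 2 ^ (-(ε / 2 * s)) := by
        rw [← Real.rpow_add two_pos]
        congr 1
        ring

/-- Reed–Muller codes of rate close to capacity leave little conditional entropy. -/
theorem exists_degree_of_sqrt_large {δ : ℝ} (h0 : 0 < δ) (h1 : δ < 1 / 2) {d : ℝ} (hd : 0 < d)
    (hd1 : d ≤ 1) :
    ∃ c > (0 : ℝ), ∃ s₀ : ℝ, ∀ m : ℕ, s₀ ≤ √m → ∃ r,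
      (1 - d) * (1 - Hbin δ) ≤ rmRate m r ∧
      condEnt (noise m δ) (Wle m r) (Wgt m r) ≤ 2 ^ m * (2 : ℝ) ^ (-(c * √m)) := by
  have hlog : (0 : ℝ) < Real.log 2 := Real.log_pos one_lt_two
  have hH1 : Hbin δ < 1 := Hbin_lt_one h1.ne
  have hH0 : 0 < Hbin δ := Hbin_pos h0 (by linarith)
  set σ : ℝ := d / 2 * (1 - Hbin δ) with hσ
  set R : ℝ := (1 - d / 2) * (1 - Hbin δ) with hR
  have hσ0 : 0 < σ := mul_pos (by linarith) (by linarith)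
  have hσ1 : σ ≤ 1 / 2 := by nlinarith
  have hR0 : 0 < R := mul_pos (by linarith) (by linarith)
  have hR1 : R < 1 := by nlinarith
  set ε : ℝ := σ / 4 with hε
  have hε0 : 0 < ε := by positivity
  set μ : ℝ := Real.log 2 * σ with hμ
  have hμ0 : 0 < μ := by positivity
  set B : ℝ := 1 / μ ^ 2 with hB
  have hB0 : 0 ≤ B := by positivity
  refine ⟨ε / 2, by positivity, max (2 / R) (max (2 / ε)
    (2 * (4 * B + 8) / Real.log 2 ^ 2 / (ε / 2))), fun M hM => ?_⟩
  obtain ⟨hM1, hM2⟩ := max_le_iff.1 hM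
  obtain ⟨hM2, hM3⟩ := max_le_iff.1 hM2
  set s : ℝ := √M with hs
  have hs0 : 0 ≤ s := Real.sqrt_nonneg _
  have hsq : s ^ 2 = M := Real.sq_sqrt (Nat.cast_nonneg M)
  have hεs : 2 ≤ ε * s := by
    rw [div_le_iff₀ hε0] at hM2
    linarith
  have hRs : 2 ≤ R * s := by
    rw [div_le_iff₀ hR0] at hM1
    linarith
  have hBs : 2 * (4 * B + 8) / Real.log 2 ^ 2 ≤ ε / 2 * s := by
    rw [div_le_iff₀ (by positivity)] at hM3
    linarith
  have hεs' : ε * s ≤ s / 2 := by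
    have : ε * s ≤ 1 / 2 * s := mul_le_mul_of_nonneg_right (by linarith) hs0
    linarith
  have hs1 : 1 ≤ s := by linarith
  have hss : s ≤ s ^ 2 := le_self_pow₀ hs1 two_ne_zero
  obtain ⟨k, hk, hk'⟩ : ∃ k : ℕ, (k : ℝ) ≤ ε * s ∧ ε * s < k + 1 :=
    ⟨⌊ε * s⌋₊, Nat.floor_le (by positivity), Nat.lt_floor_add_one _⟩
  have hkM : k ≤ M := by
    have : (k : ℝ) ≤ M := by linarith
    exact_mod_cast this
  obtain ⟨m, rfl⟩ : ∃ m, M = m + k := ⟨M - k, by omega⟩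
  have hMcast : s ^ 2 = m + k := by
    rw [hsq]
    push_cast
    rfl
  have hm : s ^ 2 / 2 ≤ m := by linarith
  have hsm : s / 2 ≤ √(m + 1) := by
    refine Real.le_sqrt_of_sq_le ?_
    rw [div_pow]
    linarith [sq_nonneg s]
  obtain ⟨r, hr1, hr2⟩ := exists_rmRate_near (m := m) (R := R) (by
    have hpow : (m : ℝ) ≤ 2 ^ m := by exact_mod_cast Nat.lt_two_pow_self.le
    have hRm : R * (s ^ 2 / 2) ≤ R * 2 ^ m := mul_le_mul_of_nonneg_left (hm.trans hpow) hR0.le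
    have hRs2 : 2 * s ≤ R * s * s := mul_le_mul_of_nonneg_right hRs hs0
    have e : R * (s ^ 2 / 2) = R * s * s / 2 := by ring
    rw [div_le_iff₀ (by positivity)]
    linarith) hR1
  refine ⟨r, ?_, ?_⟩
  · have h := rmRate_add_ge m k r
    have hfrac : (k + 1) / √(m + 1) ≤ σ := by
      have hσs : σ * (s / 2) ≤ σ * √(m + 1) := mul_le_mul_of_nonneg_left hsm hσ0.le
      have e : σ * (s / 2) = 2 * (ε * s) := by
        rw [hε]
        ring
      rw [div_le_iff₀ (by linarith)]
      linarith
    rw [add_div] at hfrac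
    have hsplit : (1 - d) * (1 - Hbin δ) = R - σ := by
      rw [hR, hσ]
      ring
    linarith
  · have hgap : 1 - Hbin δ - R = σ := by
      rw [hR, hσ]
      ring
    have hmean := le_cubeMean_estimator_reedMuller h0 h1 m r (hr1.trans (by linarith))
    have hμle : μ ≤ cubeMean δ (estimator (reedMuller m r) δ 0) := by
      refine le_trans (mul_le_mul_of_nonneg_left ?_ hlog.le) hmean
      have : (binomLe m r : ℝ) / 2 ^ m ≤ R := hr1
      linarith
    have hk1 : 1 ≤ k := by
      have : (0 : ℝ) < k := by linarith
      exact_mod_cast this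
    refine (condEnt_reedMuller_le h0 h1 hk1 hμ0 hμle).trans
      (mul_le_mul_of_nonneg_left ?_ (by positivity))
    rw [← mul_one_div (k : ℝ), ← hB]
    exact half_pow_mul_le hB0 hk (by linarith) (by linarith) hBs

/-- for every `δ ∈ (0,1/2)` and `d > 0` there are `c > 0`, `m₀` and a
sequence `r̃(m)` with (i) `liminf binom(m, ≤ r̃(m))/2^m ≥ (1-d)(1-H(δ))`, and
(ii) `H(W^{(m)}_{≤ r̃(m)} | W^{(m)}_{> r̃(m)}) ≤ 2^m · 2^{-c√m}` for all `m ≥ m₀`. -/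
theorem stmt13 (δ : ℝ) (hδ : δ ∈ Set.Ioo 0 (1/2 : ℝ)) (d : ℝ) (hd : 0 < d) :
    ∃ c > (0 : ℝ), ∃ m₀ : ℕ, ∃ rt : ℕ → ℕ,
      (1 - d) * (1 - Hbin δ)
          ≤ Filter.liminf (fun m : ℕ => (binomLe m (rt m) : ℝ) / 2 ^ m) Filter.atTop
      ∧ ∀ m ≥ m₀,
          condEnt (noise m δ) (Wle m (rt m)) (Wgt m (rt m))
            ≤ 2 ^ m * (2 : ℝ) ^ (-(c * Real.sqrt m)) := by
  classical
  have hH : Hbin δ < 1 := Hbin_lt_one hδ.2.ne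
  obtain ⟨c, hc, s₀, h⟩ := exists_degree_of_sqrt_large hδ.1 hδ.2 (d := min d 1) (by positivity)
    (min_le_right _ _)
  have hlarge : ∀ᶠ m : ℕ in Filter.atTop, s₀ ≤ √(m : ℝ) :=
    (Real.tendsto_sqrt_atTop.comp tendsto_natCast_atTop_atTop).eventually_ge_atTop s₀
  obtain ⟨m₀, hm₀⟩ := Filter.eventually_atTop.1 hlarge
  choose! rt hrt using fun m (hm : m₀ ≤ m) => h m (hm₀ m hm)
  refine ⟨c, hc, m₀, rt, ?_, fun m hm => (hrt m hm).2⟩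
  refine Filter.le_liminf_of_le ?_ ?_
  · exact Filter.isCoboundedUnder_ge_of_le _ (x := 1) fun m => rmRate_le_one m (rt m)
  · filter_upwards [Filter.eventually_ge_atTop m₀] with m hm
    refine le_trans (mul_le_mul_of_nonneg_right ?_ (by linarith)) (hrt m hm).1
    linarith [min_le_left d 1]
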